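/- Let 0 ≤ r < 1, let U be a mild solution of the Klein-Gordon system on 𝕋 with U ∈ L^∞(0,T; H^{1+r}(𝕋) × H^r(𝕋)), and set R₁(t_n) := ∫_{−τ}^{τ} e^{−sL} [ F(U(t_n + s)) − F(e^{sL} U(t_n)) ] ds. Then ||R₁(t_n)||₁ ≲ τ^{2+r} ( 1 + max_{s∈[−τ,τ]} ||U(t_n+s)||_{1+r} + max_{s∈[−τ,τ]} ||U(t_n+s)||₀ )². -/

import Mathlib

open MeasureTheory Real Set

namespace KG

/-- Points of the `d`-dimensional torus `𝕋^d`, modeled by `ℝ^d` together with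
`1`-periodic functions. -/
abbrev Pt (d : ℕ) := Fin d → ℝ

/-- Real-valued fields on the torus. -/
abbrev Fn (d : ℕ) := Pt d → ℝ

/-- A pair `U = (u, ∂ₜ u)`. -/
abbrev Pair (d : ℕ) := Fn d × Fn d

/-- A fundamental domain of the torus. -/
def box (d : ℕ) : Set (Pt d) := Set.univ.pi fun _ => Set.Ico (0:ℝ) 1

/-- `1`-periodicity in each coordinate direction. -/
def Per {d : ℕ} (u : Fn d) : Prop := ∀ x i, u (x + Pi.single i 1) = u x

/-- The character `e^{2π i k·x}` of the torus. -/
noncomputable def ch {d : ℕ} (k : Fin d → ℤ) (x : Pt d) : ℂ :=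
  Complex.exp (2 * (Real.pi : ℂ) * Complex.I * ∑ i, (k i : ℂ) * (x i : ℂ))

/-- The `k`-th Fourier coefficient of `u`. -/
noncomputable def fc {d : ℕ} (u : Fn d) (k : Fin d → ℤ) : ℂ :=
  ∫ x in box d, (u x : ℂ) * ch (-k) x

/-- `|k|`. -/
noncomputable def freq {d : ℕ} (k : Fin d → ℤ) : ℝ := Real.sqrt (∑ i, ((k i : ℝ))^2)

/-- The bracket `⟨k⟩ = max(|k|, 1)`. -/
noncomputable def jb {d : ℕ} (k : Fin d → ℤ) : ℝ := max (freq k) 1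

/-- The (inhomogeneous) Sobolev norm `‖u‖_{H^α(𝕋^d)}`, defined on the Fourier side. -/
noncomputable def sob {d : ℕ} (α : ℝ) (u : Fn d) : ℝ :=
  Real.sqrt (∑' k : Fin d → ℤ, jb k ^ (2*α) * ‖fc u k‖^2)

/-- The homogeneous Sobolev norm `‖u‖_{Ḣ^α(𝕋^d)}`. -/
noncomputable def hsob {d : ℕ} (α : ℝ) (u : Fn d) : ℝ :=
  Real.sqrt (∑' k : Fin d → ℤ, freq k ^ (2*α) * ‖fc u k‖^2)

/-- Membership `u ∈ H^α(𝕋^d)`. -/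
def MemSob {d : ℕ} (α : ℝ) (u : Fn d) : Prop :=
  Summable fun k : Fin d → ℤ => jb k ^ (2*α) * ‖fc u k‖^2

/-- The norm `‖W‖_α = (‖w₁‖²_{H^α} + ‖w₂‖²_{H^{α-1}})^{1/2}` of a pair. -/
noncomputable def pnorm {d : ℕ} (α : ℝ) (U : Pair d) : ℝ :=
  Real.sqrt (sob α U.1 ^ 2 + sob (α-1) U.2 ^ 2)

/-- The energy-type norm `|W|_α = (‖w₁‖²_{Ḣ^α} + ‖w₂‖²_{H^{α-1}})^{1/2}` of a pair. -/
noncomputable def penorm {d : ℕ} (α : ℝ) (U : Pair d) : ℝ :=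
  Real.sqrt (hsob α U.1 ^ 2 + sob (α-1) U.2 ^ 2)

/-- Membership `W ∈ H^α(𝕋^d) × H^{α-1}(𝕋^d)`. -/
def PMem {d : ℕ} (α : ℝ) (U : Pair d) : Prop := MemSob α U.1 ∧ MemSob (α-1) U.2

/-- The frequency `ω_k = 2π|k|` of the wave operator on the `k`-th mode. -/
noncomputable def omg {d : ℕ} (k : Fin d → ℤ) : ℝ := 2 * Real.pi * freq k

/-- `sin(ωt)/ω`, extended by its limit `t` at `ω = 0`. -/
noncomputable def snc (ω t : ℝ) : ℝ := if ω = 0 then t else Real.sin (ω * t) / ω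

/-- The group `e^{tL}`, `L = [[0,I],[Δ,0]]`, acting modewise by
`[[cos(ω_k t), sin(ω_k t)/ω_k], [-ω_k sin(ω_k t), cos(ω_k t)]]`. -/
noncomputable def expL {d : ℕ} (t : ℝ) (U : Pair d) : Pair d :=
  (fun x => (∑' k : Fin d → ℤ,
      ((Real.cos (omg k * t) : ℂ) * fc U.1 k + ((snc (omg k) t : ℝ) : ℂ) * fc U.2 k)
        * ch k x).re,
   fun x => (∑' k : Fin d → ℤ,
      (((-(omg k) * Real.sin (omg k * t) : ℝ) : ℂ) * fc U.1 k
        + (Real.cos (omg k * t) : ℂ) * fc U.2 k) * ch k x).re)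

/-- The nonlinearity `F(U) = (0, f(u))ᵀ`. -/
def Fnl {d : ℕ} (f : ℝ → ℝ) (U : Pair d) : Pair d :=
  (fun _ => 0, fun x => f (U.1 x))

/-- `H(U) = (-f(u), f'(u) v)ᵀ`. -/
noncomputable def Hnl {d : ℕ} (f : ℝ → ℝ) (U : Pair d) : Pair d :=
  (fun x => -(f (U.1 x)), fun x => deriv f (U.1 x) * U.2 x)

/-- Componentwise (pointwise) integral of a `Pair`-valued map. -/
noncomputable def pInt {d : ℕ} (a b : ℝ) (G : ℝ → Pair d) : Pair d :=
  (fun x => ∫ s in a..b, (G s).1 x, fun x => ∫ s in a..b, (G s).2 x)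

/-- Mild (energy) solution: the variation-of-constants (Duhamel) formula. -/
def IsMild {d : ℕ} (f : ℝ → ℝ) (T : ℝ) (U : ℝ → Pair d) : Prop :=
  ∀ t s : ℝ, 0 ≤ t → 0 ≤ s → t + s ≤ T →
    U (t + s) = expL s (U t) + pInt 0 s fun σ => expL (s - σ) (Fnl f (U (t + σ)))

/-- `τ² e^{τL} φ₂(-2τL) W = ∫₀^τ (τ-s) e^{(τ-2s)L} W ds`, where
`φ₂(A) = A⁻²(e^A - A - I)`. -/
noncomputable def corrNeg {d : ℕ} (τ : ℝ) (W : Pair d) : Pair d :=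
  pInt 0 τ fun s => (τ - s) • expL (τ - 2*s) W

/-- `τ² e^{τL} φ₂(2τL) W = ∫₀^τ (τ-s) e^{(τ+2s)L} W ds`. -/
noncomputable def corrPos {d : ℕ} (τ : ℝ) (W : Pair d) : Pair d :=
  pInt 0 τ fun s => (τ - s) • expL (τ + 2*s) W

/-- The product norm `|||(V₁,V₂)|||_α = (‖V₁‖_α² + ‖V₂‖_α²)^{1/2}`. -/
noncomputable def tnorm {d : ℕ} (α : ℝ) (UU : Pair d × Pair d) : ℝ :=
  Real.sqrt (pnorm α UU.1 ^ 2 + pnorm α UU.2 ^ 2)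


/-! ### Fourier basics on the one-dimensional torus -/

abbrev KK := Fin 1 → ℤ

lemma ch_norm (k : KK) (x : Pt 1) : ‖ch k x‖ = 1 := by
  unfold ch
  have : 2 * (Real.pi : ℂ) * Complex.I * ∑ i, (k i : ℂ) * (x i : ℂ)
      = ((2 * Real.pi * ∑ i, (k i : ℝ) * x i : ℝ) : ℂ) * Complex.I := by
    push_cast; ring
  rw [this, Complex.norm_exp_ofReal_mul_I]

lemma ch_cont (k : KK) : Continuous (ch k) := by
  unfold ch; fun_prop

lemma ch_add (k j : KK) (x : Pt 1) : ch (k + j) x = ch k x * ch j x := by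
  unfold ch
  rw [← Complex.exp_add]; congr 1
  simp; ring

lemma ch_zero (x : Pt 1) : ch (0 : KK) x = 1 := by simp [ch]

lemma ch_conj (k : KK) (x : Pt 1) : (starRingEnd ℂ) (ch k x) = ch (-k) x := by
  unfold ch
  rw [← Complex.exp_conj]; congr 1
  have h2 : (starRingEnd ℂ) 2 = 2 := Complex.conj_ofNat 2
  simp [h2]

lemma box_meas : MeasurableSet (box 1) :=
  MeasurableSet.univ_pi fun _ => measurableSet_Ico

lemma box_vol : volume (box 1) = 1 := by
  unfold box; rw [Real.volume_pi_Ico]; simp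

noncomputable abbrev mu : Measure (Pt 1) := volume.restrict (box 1)

instance mu_prob : IsProbabilityMeasure mu := ⟨by simp [mu, box_vol]⟩

lemma int_box (g : ℝ → ℂ) : ∫ x, g (x 0) ∂mu = ∫ y in Set.Ico (0:ℝ) 1, g y := by
  have h := volume_preserving_funUnique (Fin 1) ℝ
  have h2 := h.setIntegral_preimage_emb (MeasurableEquiv.measurableEmbedding _) g (Set.Ico (0:ℝ) 1)
  rw [← h2]
  have : box 1 = (MeasurableEquiv.funUnique (Fin 1) ℝ) ⁻¹' Set.Ico (0:ℝ) 1 := by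
    ext x; simp [box, Set.mem_pi]
  rw [mu, this]
  rfl

lemma ch_int (k : KK) : ∫ x, ch k x ∂mu = if k = 0 then 1 else 0 := by
  split_ifs with hk
  · subst hk; simp [ch_zero]
  · have hk0 : k 0 ≠ 0 := by
      intro h; apply hk; ext i; fin_cases i; simpa using h
    have h1 : ∀ x : Pt 1, ch k x = (fun y : ℝ => Complex.exp ((2 * (Real.pi : ℂ) * Complex.I * (k 0 : ℂ)) * (y:ℂ))) (x 0) := by
      intro x; simp [ch]; ring_nf
    simp_rw [h1]
    rw [int_box (fun y : ℝ => Complex.exp ((2 * (Real.pi : ℂ) * Complex.I * (k 0 : ℂ)) * (y:ℂ)))]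
    rw [integral_Ico_eq_integral_Ioc, ← intervalIntegral.integral_of_le zero_le_one]
    rw [integral_exp_mul_complex]
    · have : Complex.exp (2 * (Real.pi : ℂ) * Complex.I * (k 0 : ℂ)) = 1 := by
        rw [Complex.exp_eq_one_iff]; exact ⟨k 0, by ring⟩
      simp [this]
    · have := Real.pi_ne_zero
      simp [hk0, this]

lemma cont_int {E : Type*} [NormedAddCommGroup E] {w : Pt 1 → E} (hw : Continuous w) :
    Integrable w mu := by
  have hc : IsCompact (Set.univ.pi fun _ : Fin 1 => Set.Icc (0:ℝ) 1) :=
    isCompact_univ_pi fun _ => isCompact_Icc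
  have := hw.continuousOn.integrableOn_compact (μ := volume) hc
  apply this.mono_set
  exact Set.pi_mono fun _ _ => Set.Ico_subset_Icc_self

noncomputable def ser (c : KK → ℂ) (x : Pt 1) : ℂ := ∑' k, c k * ch k x

def Sym (c : KK → ℂ) : Prop := ∀ k, c (-k) = (starRingEnd ℂ) (c k)

lemma ser_summable {c : KK → ℂ} (hc : Summable c) (x : Pt 1) : Summable fun k => c k * ch k x := by
  apply Summable.of_norm
  simpa [ch_norm] using hc.norm

lemma ser_zero {c : KK → ℂ} (hc : ¬ Summable c) (x : Pt 1) : ser c x = 0 := by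
  apply tsum_eq_zero_of_not_summable
  intro h
  apply hc
  have := h.norm
  simp only [norm_mul, ch_norm, mul_one] at this
  exact this.of_norm

lemma ser_cont {c : KK → ℂ} (hc : Summable c) : Continuous (ser c) := by
  apply continuous_tsum (u := fun k => ‖c k‖)
  · intro k; exact continuous_const.mul (ch_cont k)
  · exact hc.norm
  · intro k x; simp [ch_norm]

lemma ser_norm {c : KK → ℂ} (hc : Summable c) (x : Pt 1) : ‖ser c x‖ ≤ ∑' k, ‖c k‖ := by
  unfold ser
  refine (norm_tsum_le_tsum_norm ?_).trans (le_of_eq ?_)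
  · simpa [ch_norm] using hc.norm
  · simp [ch_norm]

lemma ser_coef {c : KK → ℂ} (hc : Summable c) (k : KK) : ∫ x, ser c x * ch (-k) x ∂mu = c k := by
  have h1 : ∀ x, ser c x * ch (-k) x = ∑' j, c j * ch (j - k) x := by
    intro x; unfold ser
    rw [← tsum_mul_right]; congr 1; ext j
    rw [sub_eq_add_neg, ch_add]; ring
  simp_rw [h1]
  rw [← integral_tsum_of_summable_integral_norm]
  · simp_rw [integral_const_mul, ch_int]
    rw [tsum_eq_single k]
    · simp
    · intro j hj; simp [sub_eq_zero, hj]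
  · intro j; exact (cont_int (continuous_const.mul (ch_cont _)))
  · simpa [ch_norm] using hc.norm

lemma ser_real {c : KK → ℂ} (hs : Sym c) (x : Pt 1) : (((ser c x).re : ℝ) : ℂ) = ser c x := by
  rw [← Complex.conj_eq_iff_re]
  unfold ser
  rw [Complex.conj_tsum]
  rw [← (Equiv.neg KK).tsum_eq]
  congr 1; ext k
  simp [ch_conj, hs k]

lemma fc_ser {c : KK → ℂ} (hs : Sym c) (hc : Summable c) (k : KK) :
    fc (fun x => (ser c x).re) k = c k := by
  unfold fc
  simp_rw [ser_real hs]
  exact ser_coef hc k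

lemma fc_ser_le {c : KK → ℂ} (hs : Sym c) (k : KK) :
    ‖fc (fun x => (ser c x).re) k‖ ≤ ‖c k‖ := by
  by_cases hc : Summable c
  · rw [fc_ser hs hc]
  · simp [fc, ser_zero hc]

lemma summable_sq {c : KK → ℂ} (hc : Summable c) : Summable fun k => ‖c k‖^2 := by
  have h := hc.norm
  apply Summable.of_norm_bounded_eventually h
  have := h.tendsto_cofinite_zero
  filter_upwards [this.eventually (gt_mem_nhds zero_lt_one)] with k hk
  simp only [norm_pow, norm_norm]
  nlinarith [norm_nonneg (c k)]

lemma parseval_le {c : KK → ℂ} (hc : Summable c) :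
    ∫ x, (ser c x).re^2 ∂mu ≤ ∑' k, ‖c k‖^2 := by
  have h2 : ∫ x, ser c x * (starRingEnd ℂ) (ser c x) ∂mu = ∑' k, (starRingEnd ℂ) (c k) * c k := by
    have h1 : ∀ x, ser c x * (starRingEnd ℂ) (ser c x)
        = ∑' k, (starRingEnd ℂ) (c k) * (ser c x * ch (-k) x) := by
      intro x
      conv_lhs => rw [show (starRingEnd ℂ) (ser c x) = ∑' k, (starRingEnd ℂ) (c k * ch k x) from
        Complex.conj_tsum _]
      rw [← tsum_mul_left]; congr 1; ext k
      simp only [map_mul, ch_conj]; ring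
    simp_rw [h1]
    rw [← integral_tsum_of_summable_integral_norm]
    · simp_rw [integral_const_mul, ser_coef hc]
    · intro k; exact cont_int (continuous_const.mul ((ser_cont hc).mul (ch_cont _)))
    · have : ∀ k, ∫ x, ‖(starRingEnd ℂ) (c k) * (ser c x * ch (-k) x)‖ ∂mu
          = ‖c k‖ * ∫ x, ‖ser c x‖ ∂mu := by
        intro k
        rw [← integral_const_mul]; simp [ch_norm]
      simp_rw [this]
      exact hc.norm.mul_right _
  have h3 : ∫ x, ‖ser c x‖^2 ∂mu = ∑' k, ‖c k‖^2 := by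
    have e1 : ∀ z : ℂ, z * (starRingEnd ℂ) z = ((‖z‖^2 : ℝ) : ℂ) := by
      intro z; rw [Complex.mul_conj, Complex.normSq_eq_norm_sq]
    have e2 : ∀ z : ℂ, (starRingEnd ℂ) z * z = ((‖z‖^2 : ℝ) : ℂ) := by
      intro z; rw [mul_comm, e1]
    simp_rw [e1, e2] at h2
    rw [integral_complex_ofReal, ← Complex.ofReal_tsum] at h2
    exact_mod_cast h2
  rw [← h3]
  apply integral_mono
  · exact cont_int ((Complex.continuous_re.comp (ser_cont hc)).pow 2)
  · exact cont_int ((ser_cont hc).norm.pow 2)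
  · intro x
    simp only
    rw [← sq_abs]
    gcongr
    exact Complex.abs_re_le_norm _

lemma fc_sym (w : Fn 1) : Sym (fc w) := by
  intro k
  unfold fc
  rw [← integral_conj]
  congr 1; ext x
  simp [ch_conj]

lemma fc_zero (k : KK) : fc (fun _ : Pt 1 => (0:ℝ)) k = 0 := by simp [fc]

lemma fc_int {w : Fn 1} (hw : Continuous w) (k : KK) :
    Integrable (fun x => (w x : ℂ) * ch (-k) x) mu :=
  cont_int ((Complex.continuous_ofReal.comp hw).mul (ch_cont _))

lemma fc_sub {w v : Fn 1} (hw : Continuous w) (hv : Continuous v) (k : KK) :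
    fc (fun x => w x - v x) k = fc w k - fc v k := by
  unfold fc
  rw [← integral_sub (fc_int hw k) (fc_int hv k)]
  congr 1; ext x; push_cast; ring

lemma bessel_fin {w : Fn 1} (hw : Continuous w) (F : Finset KK) :
    ∑ k ∈ F, ‖fc w k‖^2 ≤ ∫ x, (w x)^2 ∂mu := by
  -- the function c = fc w on F, zero off F
  classical
  set c : KK → ℂ := fun k => if k ∈ F then fc w k else 0 with hc
  have hcs : Summable c := summable_of_ne_finset_zero (s := F) (fun k hk => by simp [hc, hk])
  have hser : ∀ x, ser c x = ∑ k ∈ F, fc w k * ch k x := by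
    intro x; unfold ser
    rw [tsum_eq_sum (s := F) (fun k hk => by simp [hc, hk])]
    apply Finset.sum_congr rfl; intro k hk; simp [hc, hk]
  have hcc := ser_cont hcs
  -- cross term
  have hx : ∫ x, (w x : ℂ) * (starRingEnd ℂ) (ser c x) ∂mu = ((∑ k ∈ F, ‖fc w k‖^2 : ℝ) : ℂ) := by
    have : ∀ x, (w x : ℂ) * (starRingEnd ℂ) (ser c x)
        = ∑ k ∈ F, (starRingEnd ℂ) (fc w k) * ((w x : ℂ) * ch (-k) x) := by
      intro x; rw [hser, map_sum, Finset.mul_sum]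
      apply Finset.sum_congr rfl; intro k hk
      simp only [map_mul, ch_conj]; ring
    simp_rw [this]
    rw [integral_finsetSum _ (fun k _ => (fc_int hw k).const_mul _)]
    simp_rw [integral_const_mul]
    push_cast
    apply Finset.sum_congr rfl; intro k hk
    change _ * fc w k = _
    rw [mul_comm, Complex.mul_conj, Complex.normSq_eq_norm_sq]; push_cast; rfl
  have hx2 : ∫ x, w x * (ser c x).re ∂mu = ∑ k ∈ F, ‖fc w k‖^2 := by
    have h := congrArg Complex.re hx
    rw [Complex.ofReal_re] at h
    rw [← h]
    have := integral_re (𝕜 := ℂ) (μ := mu) (f := fun x => (w x : ℂ) * (starRingEnd ℂ) (ser c x))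
      (cont_int ((Complex.continuous_ofReal.comp hw).mul (Complex.continuous_conj.comp hcc)))
    simp only [RCLike.re_eq_complex_re] at this
    rw [← this]
    congr 1; ext x; simp
  have hp := parseval_le hcs
  have ht : ∑' k, ‖c k‖^2 = ∑ k ∈ F, ‖fc w k‖^2 := by
    rw [tsum_eq_sum (s := F) (fun k hk => by simp [hc, hk])]
    apply Finset.sum_congr rfl; intro k hk; simp [hc, hk]
  rw [ht] at hp
  have hrc : Continuous fun x => (ser c x).re := Complex.continuous_re.comp hcc
  have hpos : 0 ≤ ∫ x, (w x - (ser c x).re)^2 ∂mu := integral_nonneg fun x => sq_nonneg _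
  have hexp : ∫ x, (w x - (ser c x).re)^2 ∂mu
      = ∫ x, (w x)^2 ∂mu - 2 * ∫ x, w x * (ser c x).re ∂mu + ∫ x, (ser c x).re^2 ∂mu := by
    rw [← integral_const_mul, ← integral_sub, ← integral_add]
    · congr 1; ext x; ring
    · exact cont_int ((hw.pow 2).sub (continuous_const.mul (hw.mul hrc)))
    · exact cont_int (hrc.pow 2)
    · exact cont_int (hw.pow 2)
    · exact cont_int (continuous_const.mul (hw.mul hrc))
  rw [hexp, hx2] at hpos
  linarith

lemma bessel_summable {w : Fn 1} (hw : Continuous w) : Summable fun k => ‖fc w k‖^2 :=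
  summable_of_sum_le (fun _ => by positivity) (bessel_fin hw)

lemma bessel {w : Fn 1} (hw : Continuous w) : ∑' k, ‖fc w k‖^2 ≤ ∫ x, (w x)^2 ∂mu :=
  (bessel_summable hw).tsum_le_of_sum_le (bessel_fin hw)

/-! ### Interchanging the time integral with Fourier coefficients -/

lemma ser_joint_meas {c : ℝ → KK → ℂ} (hc : ∀ k, Continuous fun s => c s k) :
    Measurable fun p : ℝ × Pt 1 => (ser (c p.1) p.2).re := by
  classical
  have hS : MeasurableSet {s : ℝ | Summable (c s)} := by
    have : {s : ℝ | Summable (c s)} = {s : ℝ | ∑' k, ENNReal.ofReal ‖c s k‖ ≠ ⊤} := by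
      ext s
      simp only [Set.mem_ofPred_eq]
      constructor
      · intro h
        exact h.norm.tsum_ofReal_ne_top
      · intro h
        have := ENNReal.summable_toReal h
        simp only [ENNReal.toReal_ofReal (norm_nonneg _)] at this
        exact this.of_norm
    rw [this]
    have hm : Measurable fun s : ℝ => ∑' k, ENNReal.ofReal ‖c s k‖ :=
      Measurable.tsum fun k => ((hc k).norm.measurable).ennreal_ofReal
    exact (hm (measurableSet_singleton ⊤)).compl
  have key : Measurable fun p : ℝ × Pt 1 => ser (c p.1) p.2 := by
    have h1 : (fun p : ℝ × Pt 1 => ser (c p.1) p.2) = fun p : ℝ × Pt 1 =>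
        ser (fun k => if Summable (c p.1) then c p.1 k else 0) p.2 := by
      ext p
      by_cases h : Summable (c p.1)
      · simp [h]
      · rw [ser_zero h]; simp [h, ser]
    rw [h1]
    have h2 : ∀ p : ℝ × Pt 1, Filter.Tendsto (fun F : Finset KK =>
        ∑ k ∈ F, (if Summable (c p.1) then c p.1 k else 0) * ch k p.2) Filter.atTop
        (nhds (ser (fun k => if Summable (c p.1) then c p.1 k else 0) p.2)) := by
      intro p
      have : Summable (fun k => if Summable (c p.1) then c p.1 k else 0) := by
        by_cases h : Summable (c p.1)
        · simp [h]
        · simp [h]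
      exact (ser_summable this p.2).hasSum
    refine measurable_of_tendsto_metrizable' (u := Filter.atTop) (f := fun (F : Finset KK) (p : ℝ × Pt 1) =>
        ∑ k ∈ F, (if Summable (c p.1) then c p.1 k else 0) * ch k p.2) ?_ (tendsto_pi_nhds.2 h2)
    intro F
    apply Finset.measurable_fun_sum
    intro k hk
    apply Measurable.mul
    · apply Measurable.ite
      · exact measurable_fst hS
      · exact (hc k).measurable.comp measurable_fst
      · exact measurable_const
    · exact (ch_cont k).measurable.comp measurable_snd
  exact Complex.measurable_re.comp key

lemma ser_L1 {c : KK → ℂ} {M : ℝ} (hM0 : 0 ≤ M) (hM : ∑' k, ‖c k‖^2 ≤ M) :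
    Integrable (fun x => (ser c x).re) mu ∧ ∫ x, |(ser c x).re| ∂mu ≤ 1 + M := by
  by_cases hc : Summable c
  · have hrc : Continuous fun x => (ser c x).re := Complex.continuous_re.comp (ser_cont hc)
    refine ⟨cont_int hrc, ?_⟩
    have h := parseval_le hc
    have hrc2 : Integrable (fun x => (ser c x).re^2) mu := cont_int (hrc.pow 2)
    have : ∫ x, |(ser c x).re| ∂mu ≤ ∫ x, (1 + (ser c x).re^2) ∂mu := by
      apply integral_mono (cont_int hrc.abs) ((integrable_const (1:ℝ)).add hrc2)
      intro x
      simp only [Pi.add_apply]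
      have := sq_abs (ser c x).re
      nlinarith [sq_nonneg (|(ser c x).re| - 1), abs_nonneg (ser c x).re]
    rw [integral_add (integrable_const _) hrc2] at this
    simp at this
    linarith
  · simp [ser_zero hc]; linarith

lemma fubini_fc {c : ℝ → KK → ℂ} (hc : ∀ k, Continuous fun s => c s k) {a b M : ℝ} (hab : a ≤ b)
    (hM0 : 0 ≤ M) (hM : ∀ s ∈ Set.Icc a b, ∑' k, ‖c s k‖^2 ≤ M) (k : KK) :
    fc (fun x => ∫ s in a..b, (ser (c s) x).re) k
      = ∫ s in a..b, fc (fun x => (ser (c s) x).re) k := by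
  have hm := ser_joint_meas hc
  set ν : Measure ℝ := volume.restrict (Set.Ioc a b) with hν
  have hint0 : Integrable (fun p : ℝ × Pt 1 => (ser (c p.1) p.2).re) (ν.prod mu) := by
    rw [integrable_prod_iff hm.aestronglyMeasurable]
    constructor
    · rw [hν]
      filter_upwards [ae_restrict_mem measurableSet_Ioc] with s hs
      exact (ser_L1 hM0 (hM s ⟨hs.1.le, hs.2⟩)).1
    · apply Integrable.of_bound (C := 1 + M)
      · exact (hm.norm.stronglyMeasurable.integral_prod_right (ν := mu)).aestronglyMeasurable
      · rw [hν]
        filter_upwards [ae_restrict_mem measurableSet_Ioc] with s hs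
        rw [Real.norm_of_nonneg (integral_nonneg fun x => norm_nonneg _)]
        exact (ser_L1 hM0 (hM s ⟨hs.1.le, hs.2⟩)).2
  have hIntegrable : Integrable (fun p : ℝ × Pt 1 => (((ser (c p.1) p.2).re : ℝ) : ℂ) * ch (-k) p.2)
      (ν.prod mu) := by
    apply Integrable.mul_bdd (c := 1) hint0.ofReal
    · exact ((ch_cont (-k)).comp continuous_snd).aestronglyMeasurable
    · filter_upwards with p
      rw [ch_norm]
  simp only [intervalIntegral.integral_of_le hab]
  unfold fc
  have h1 : ∀ x : Pt 1, ((∫ s in Set.Ioc a b, (ser (c s) x).re : ℝ) : ℂ) * ch (-k) x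
      = ∫ s in Set.Ioc a b, (((ser (c s) x).re : ℝ) : ℂ) * ch (-k) x := by
    intro x
    rw [integral_mul_const, integral_complex_ofReal]
  simp_rw [h1]
  exact (integral_integral_swap hIntegrable).symm

lemma fubini_eq {c : ℝ → KK → ℂ} (hc : ∀ k, Continuous fun s => c s k) {a b M : ℝ} (hab : a ≤ b)
    (hM0 : 0 ≤ M) (hM : ∀ s ∈ Set.Icc a b, ∑' k, ‖c s k‖^2 ≤ M) (hs : ∀ s, Sym (c s))
    (hsum : ∀ s ∈ Set.Icc a b, Summable (c s)) (k : KK) :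
    fc (fun x => ∫ s in a..b, (ser (c s) x).re) k = ∫ s in a..b, c s k := by
  rw [fubini_fc hc hab hM0 hM]
  apply intervalIntegral.integral_congr
  intro s hs'
  rw [Set.uIcc_of_le hab] at hs'
  exact fc_ser (hs s) (hsum s hs') k

lemma fubini_le {c : ℝ → KK → ℂ} (hc : ∀ k, Continuous fun s => c s k) {a b M : ℝ} (hab : a ≤ b)
    (hM0 : 0 ≤ M) (hM : ∀ s ∈ Set.Icc a b, ∑' k, ‖c s k‖^2 ≤ M) (hs : ∀ s, Sym (c s)) (k : KK) :
    ‖fc (fun x => ∫ s in a..b, (ser (c s) x).re) k‖ ≤ ∫ s in a..b, ‖c s k‖ := by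
  rw [fubini_fc hc hab hM0 hM]
  apply intervalIntegral.norm_integral_le_of_norm_le hab
  · filter_upwards with s _
    exact fc_ser_le (hs s) k
  · exact (hc k).norm.intervalIntegrable _ _

/-- Minkowski's inequality for finitely many integrals. -/
lemma mink {E : Type*} [NormedAddCommGroup E] [NormedSpace ℝ E] [CompleteSpace E]
    (F : Finset KK) {φ : ℝ → KK → E} (hφ : ∀ k, Continuous fun s => φ s k) {a b Q : ℝ}
    (hab : a ≤ b) (hQ : ∀ s ∈ Set.Icc a b, ∑ k ∈ F, ‖φ s k‖^2 ≤ Q) :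
    ∑ k ∈ F, ‖∫ s in a..b, φ s k‖^2 ≤ (b - a)^2 * Q := by
  classical
  have hi : ∀ k, IntervalIntegrable (fun s => ‖φ s k‖) volume a b :=
    fun k => (hφ k).norm.intervalIntegrable _ _
  have cs : ∀ k, ‖∫ s in a..b, φ s k‖^2 ≤ (b - a) * ∫ s in a..b, ‖φ s k‖^2 := by
    intro k
    set I := ∫ s in a..b, ‖φ s k‖ with hI
    have h0 : ‖∫ s in a..b, φ s k‖ ≤ I := intervalIntegral.norm_integral_le_integral_norm hab
    have hI0 : 0 ≤ I := (norm_nonneg _).trans h0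
    have h1 : ‖∫ s in a..b, φ s k‖^2 ≤ I^2 := by gcongr
    refine h1.trans ?_
    rcases hab.eq_or_lt with h | h
    · subst h; simp [hI]
    have h2 : 0 ≤ ∫ s in a..b, ((b-a) * ‖φ s k‖ - I)^2 :=
      intervalIntegral.integral_nonneg hab fun s _ => sq_nonneg _
    have hc1 : Continuous fun s => ‖φ s k‖ := (hφ k).norm
    have h3 : ∫ s in a..b, ((b-a) * ‖φ s k‖ - I)^2
        = (b-a)^2 * (∫ s in a..b, ‖φ s k‖^2) - 2 * (b-a) * I * I + (b-a) * I^2 := by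
      have : ∀ s, ((b-a) * ‖φ s k‖ - I)^2
          = (b-a)^2 * ‖φ s k‖^2 - (2 * (b-a) * I) * ‖φ s k‖ + I^2 := by intro s; ring
      simp_rw [this]
      rw [intervalIntegral.integral_add, intervalIntegral.integral_sub,
        intervalIntegral.integral_const_mul, intervalIntegral.integral_const_mul,
        intervalIntegral.integral_const]
      · simp [hI]
      · exact (continuous_const.mul (hc1.pow 2)).intervalIntegrable _ _
      · exact (continuous_const.mul hc1).intervalIntegrable _ _
      · exact ((continuous_const.mul (hc1.pow 2)).sub (continuous_const.mul hc1)).intervalIntegrable _ _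
      · exact continuous_const.intervalIntegrable _ _
    rw [h3] at h2
    have hba : 0 < b - a := by linarith
    have h4 : 0 ≤ (b-a) * ((b-a) * (∫ s in a..b, ‖φ s k‖^2) - I^2) := by nlinarith
    have := nonneg_of_mul_nonneg_right h4 hba
    linarith
  calc ∑ k ∈ F, ‖∫ s in a..b, φ s k‖^2 ≤ ∑ k ∈ F, (b - a) * ∫ s in a..b, ‖φ s k‖^2 :=
        Finset.sum_le_sum fun k _ => cs k
    _ = (b-a) * ∫ s in a..b, ∑ k ∈ F, ‖φ s k‖^2 := by
        rw [← Finset.mul_sum, intervalIntegral.integral_finsetSum]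
        intro k _
        exact ((hφ k).norm.pow 2).intervalIntegrable _ _
    _ ≤ (b-a) * ∫ s in a..b, Q := by
        apply mul_le_mul_of_nonneg_left _ (by linarith)
        apply intervalIntegral.integral_mono_on hab
        · exact (continuous_finsetSum _ fun k _ => (hφ k).norm.pow 2).intervalIntegrable _ _
        · exact continuous_const.intervalIntegrable _ _
        · exact hQ
    _ = (b-a)^2 * Q := by simp; ring

/-! ### Symbols of the wave group -/

lemma freq_eq (k : KK) : freq k = |(k 0 : ℝ)| := by
  simp [freq, Real.sqrt_sq_eq_abs]

lemma freq_neg (k : KK) : freq (-k) = freq k := by simp [freq_eq]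

lemma omg_neg (k : KK) : omg (-k) = omg k := by simp [omg, freq_neg]

lemma jb_one (k : KK) : 1 ≤ jb k := le_max_right _ _

lemma jb_pos (k : KK) : 0 < jb k := lt_of_lt_of_le one_pos (jb_one k)

lemma freq_nonneg (k : KK) : 0 ≤ freq k := Real.sqrt_nonneg _

lemma omg_nonneg (k : KK) : 0 ≤ omg k := by
  have := freq_nonneg k
  have := Real.pi_pos
  unfold omg; positivity

lemma omg_le (k : KK) : omg k ≤ 2 * Real.pi * jb k := by
  have : freq k ≤ jb k := le_max_left _ _
  have := Real.pi_pos
  unfold omg; gcongr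

lemma jb_le_omg (k : KK) (h : omg k ≠ 0) : jb k ≤ omg k := by
  have hf : freq k ≠ 0 := by intro h'; apply h; simp [omg, h']
  have h1 : 1 ≤ freq k := by
    rw [freq_eq] at *
    have : k 0 ≠ 0 := by intro h'; apply hf; simp [h']
    exact_mod_cast Int.one_le_abs this
  have h2 : jb k = freq k := max_eq_left h1
  rw [h2]; unfold omg
  nlinarith [Real.pi_gt_three]

lemma snc_lip (ω s t : ℝ) : |snc ω s - snc ω t| ≤ |s - t| := by
  unfold snc
  split_ifs with h
  · exact le_rfl
  · rw [← sub_div, abs_div, div_le_iff₀ (abs_pos.2 h)]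
    have := Real.lipschitzWith_sin.dist_le_mul (ω * s) (ω * t)
    simp only [Real.dist_eq, NNReal.coe_one, one_mul] at this
    rw [← mul_sub, abs_mul] at this
    linarith

lemma snc_zero (ω : ℝ) : snc ω 0 = 0 := by unfold snc; split_ifs <;> simp

lemma snc_abs (ω t : ℝ) : |snc ω t| ≤ |t| := by
  simpa [snc_zero] using snc_lip ω t 0

lemma snc_neg (ω t : ℝ) : snc ω (-t) = - snc ω t := by
  unfold snc; split_ifs <;> simp [neg_div]

lemma snc_jb (k : KK) (t : ℝ) : jb k * |snc (omg k) t| ≤ 1 + |t| := by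
  by_cases h : omg k = 0
  · have : freq k = 0 := by
      have := Real.pi_pos.ne'
      simpa [omg, this] using h
    have hj : jb k = 1 := by simp [jb, this]
    rw [hj]; have := snc_abs (omg k) t; linarith
  · have h1 := jb_le_omg k h
    have hp : 0 < omg k := lt_of_le_of_ne (omg_nonneg k) (Ne.symm h)
    have h2 : |snc (omg k) t| ≤ 1 / omg k := by
      unfold snc; rw [if_neg h, abs_div, abs_of_pos hp]
      gcongr; exact Real.abs_sin_le_one _
    calc jb k * |snc (omg k) t| ≤ omg k * (1 / omg k) := by
          gcongr
      _ = 1 := by field_simp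
      _ ≤ 1 + |t| := by linarith [abs_nonneg t]

lemma snc_deriv (ω t : ℝ) : HasDerivAt (snc ω) (Real.cos (ω * t)) t := by
  by_cases h : ω = 0
  · have : snc ω = fun t => t := by ext; simp [snc, h]
    rw [this, h]; simpa using hasDerivAt_id' t
  · have : snc ω = fun t => Real.sin (ω * t) / ω := by ext; simp [snc, h]
    rw [this]
    have h1 : HasDerivAt (fun t => ω * t) ω t := by simpa using (hasDerivAt_id t).const_mul ω
    have := (h1.sin).div_const ω
    exact this.congr_deriv (by rw [mul_div_assoc, div_self h, mul_one])

lemma snc_cont (ω : ℝ) : Continuous (snc ω) :=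
  continuous_iff_continuousAt.2 fun t => (snc_deriv ω t).continuousAt

lemma snc_sub (ω h σ : ℝ) :
    snc ω (h - σ) = snc ω h * Real.cos (ω * σ) - Real.cos (ω * h) * snc ω σ := by
  unfold snc; split_ifs with h0
  · simp [h0]
  · rw [mul_sub, Real.sin_sub]; ring

lemma snc_pyth (ω h : ℝ) : Real.cos (ω * h)^2 + ω * Real.sin (ω * h) * snc ω h = 1 := by
  unfold snc; split_ifs with h0
  · simp [h0]
  · field_simp; rw [add_comm]; exact Real.sin_sq_add_cos_sq _

lemma cos_lip (ω s t : ℝ) : |Real.cos (ω * s) - Real.cos (ω * t)| ≤ |ω| * |s - t| := by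
  have := Real.lipschitzWith_cos.dist_le_mul (ω * s) (ω * t)
  simp only [Real.dist_eq, NNReal.coe_one, one_mul] at this
  rwa [← mul_sub, abs_mul] at this

lemma jb_summable : Summable fun k : KK => 1 / jb k ^ 2 := by
  have h1 : Summable fun n : ℤ => 1 / (max |(n:ℝ)| 1)^2 := by
    have h := Real.summable_one_div_int_pow.2 (show 1 < 2 by norm_num)
    have h2 : Summable fun n : ℤ => 1 / (n:ℝ)^2 + (if n = 0 then 1 else 0) :=
      h.add (summable_of_ne_finset_zero (s := {0}) (by intro n hn; simpa using hn))
    apply Summable.of_nonneg_of_le (fun n => by positivity) _ h2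
    intro n
    by_cases hn : n = 0
    · simp [hn]
    · have : (1:ℝ) ≤ |(n:ℝ)| := by exact_mod_cast Int.one_le_abs hn
      simp [max_eq_left this, hn]
  have h2 := (Equiv.funUnique (Fin 1) ℤ).summable_iff.2 h1
  convert h2 using 2 with k
  simp [jb, freq_eq]

noncomputable def Zc : ℝ := ∑' k : KK, 1 / jb k ^ 2

lemma Zc_nonneg : 0 ≤ Zc := tsum_nonneg fun k => by positivity

lemma l1_of_weighted {c : KK → ℂ} (h : Summable fun k => jb k^2 * ‖c k‖^2) :
    Summable c ∧ ∑' k, ‖c k‖ ≤ Zc + ∑' k, jb k^2 * ‖c k‖^2 := by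
  have hle : ∀ k, ‖c k‖ ≤ 1 / jb k^2 + jb k^2 * ‖c k‖^2 := by
    intro k
    have hj := jb_pos k
    have : ‖c k‖ = (1 / jb k) * (jb k * ‖c k‖) := by field_simp
    have h2 : 1 / jb k^2 + jb k^2 * ‖c k‖^2 = (1 / jb k)^2 + (jb k * ‖c k‖)^2 := by
      field_simp
    rw [h2]; nth_rewrite 1 [this]
    nlinarith [sq_nonneg (1 / jb k - jb k * ‖c k‖), sq_nonneg (1 / jb k), sq_nonneg (jb k * ‖c k‖)]
  have hs := jb_summable.add h
  have hn : Summable fun k => ‖c k‖ := Summable.of_nonneg_of_le (fun _ => norm_nonneg _) hle hs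
  refine ⟨hn.of_norm, ?_⟩
  rw [Zc, ← jb_summable.tsum_add h]
  exact hn.tsum_le_tsum hle hs

/-- coefficients of the first component of the free evolution -/
noncomputable def Vc (t : ℝ) (W : Pair 1) (k : KK) : ℂ :=
  (Real.cos (omg k * t) : ℂ) * fc W.1 k + ((snc (omg k) t : ℝ) : ℂ) * fc W.2 k

lemma expL_fst (t : ℝ) (W : Pair 1) (x : Pt 1) : (expL t W).1 x = (ser (Vc t W) x).re := rfl

lemma Vc_sym (t : ℝ) (W : Pair 1) : Sym (Vc t W) := by
  intro k
  unfold Vc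
  rw [fc_sym W.1 k, fc_sym W.2 k, omg_neg]
  simp only [map_add, map_mul, Complex.conj_ofReal]

/-- quantitative `H¹ × L²` regularity -/
structure Reg (W : Pair 1) (N : ℝ) : Prop where
  s1 : Summable fun k => jb k^2 * ‖fc W.1 k‖^2
  s2 : Summable fun k => ‖fc W.2 k‖^2
  le : ∑' k, jb k^2 * ‖fc W.1 k‖^2 + ∑' k, ‖fc W.2 k‖^2 ≤ N^2

lemma sob_sq {α : ℝ} {u : Fn 1} : sob α u ^ 2 = ∑' k : KK, jb k ^ (2*α) * ‖fc u k‖^2 := by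
  unfold sob
  rw [Real.sq_sqrt]
  apply tsum_nonneg; intro k
  have := jb_pos k
  positivity

lemma pnorm_sq {α : ℝ} {W : Pair 1} : pnorm α W ^ 2 = sob α W.1 ^ 2 + sob (α-1) W.2 ^ 2 := by
  unfold pnorm
  rw [Real.sq_sqrt (by positivity)]

lemma pnorm_nonneg {α : ℝ} {W : Pair 1} : 0 ≤ pnorm α W := Real.sqrt_nonneg _

lemma reg_of {r N : ℝ} (hr : 0 ≤ r) {W : Pair 1} (hW : PMem (1+r) W) (hN : pnorm (1+r) W ≤ N) :
    Reg W N := by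
  have l1 : ∀ k : KK, jb k^2 * ‖fc W.1 k‖^2 ≤ jb k ^ (2*(1+r)) * ‖fc W.1 k‖^2 := by
    intro k
    gcongr
    rw [← Real.rpow_natCast]
    apply Real.rpow_le_rpow_of_exponent_le (jb_one k)
    push_cast; linarith
  have l2 : ∀ k : KK, ‖fc W.2 k‖^2 ≤ jb k ^ (2*(1+r-1)) * ‖fc W.2 k‖^2 := by
    intro k
    have : 1 ≤ jb k ^ (2*(1+r-1)) := Real.one_le_rpow (jb_one k) (by linarith)
    nlinarith [sq_nonneg ‖fc W.2 k‖]
  have s1 : Summable fun k : KK => jb k^2 * ‖fc W.1 k‖^2 :=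
    Summable.of_nonneg_of_le (fun _ => by positivity) l1 hW.1
  have s2 : Summable fun k : KK => ‖fc W.2 k‖^2 :=
    Summable.of_nonneg_of_le (fun _ => by positivity) l2 hW.2
  refine ⟨s1, s2, ?_⟩
  have h1 := s1.tsum_le_tsum l1 hW.1
  have h2 := s2.tsum_le_tsum l2 hW.2
  have h3 : pnorm (1+r) W ^ 2 ≤ N^2 := by
    have := pnorm_nonneg (α := 1+r) (W := W)
    gcongr
  rw [pnorm_sq, sob_sq, sob_sq] at h3
  linarith

lemma norm_add_sq_le (a b : ℂ) : ‖a + b‖^2 ≤ 2 * ‖a‖^2 + 2 * ‖b‖^2 := by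
  have h := norm_add_le a b
  have : ‖a + b‖^2 ≤ (‖a‖ + ‖b‖)^2 := by gcongr
  nlinarith [sq_nonneg (‖a‖ - ‖b‖)]

lemma Vc_weighted {W : Pair 1} {N : ℝ} (hW : Reg W N) (t : ℝ) :
    Summable fun k => jb k^2 * ‖Vc t W k‖^2 := by
  have hs := (hW.s1.mul_left 2).add (hW.s2.mul_left (2 * (1 + |t|)^2))
  apply Summable.of_nonneg_of_le (fun _ => by positivity) _ hs
  intro k
  have h := norm_add_sq_le ((Real.cos (omg k * t) : ℂ) * fc W.1 k) (((snc (omg k) t : ℝ) : ℂ) * fc W.2 k)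
  rw [norm_mul, norm_mul, Complex.norm_real, Complex.norm_real, Real.norm_eq_abs, Real.norm_eq_abs] at h
  change ‖Vc t W k‖^2 ≤ _ at h
  have hc : |Real.cos (omg k * t)| ≤ 1 := Real.abs_cos_le_one _
  have hj := jb_pos k
  have hsn := snc_jb k t
  calc jb k^2 * ‖Vc t W k‖^2
      ≤ jb k^2 * (2 * (|Real.cos (omg k * t)| * ‖fc W.1 k‖)^2 + 2 * (|snc (omg k) t| * ‖fc W.2 k‖)^2) := by
        gcongr
    _ = 2 * (jb k^2 * (|Real.cos (omg k * t)| * ‖fc W.1 k‖)^2)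
        + 2 * (jb k * |snc (omg k) t|)^2 * ‖fc W.2 k‖^2 := by ring
    _ ≤ 2 * (jb k^2 * (1 * ‖fc W.1 k‖)^2) + 2 * (1 + |t|)^2 * ‖fc W.2 k‖^2 := by
        gcongr
    _ = _ := by ring

lemma Vc_summable {W : Pair 1} {N : ℝ} (hW : Reg W N) (t : ℝ) : Summable (Vc t W) :=
  (l1_of_weighted (Vc_weighted hW t)).1

noncomputable def CV : ℝ := 8 * Real.pi^2

lemma CV_ge : 2 ≤ CV := by unfold CV; nlinarith [Real.pi_gt_three]

lemma Vc_diff {W : Pair 1} {N : ℝ} (hW : Reg W N) (s t : ℝ) :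
    ∑' k, ‖Vc s W k - Vc t W k‖^2 ≤ CV * (s - t)^2 * N^2 := by
  have hs := (hW.s1.mul_left (CV * (s-t)^2)).add (hW.s2.mul_left (CV * (s-t)^2))
  have hle : ∀ k, ‖Vc s W k - Vc t W k‖^2
      ≤ CV * (s-t)^2 * (jb k^2 * ‖fc W.1 k‖^2) + CV * (s-t)^2 * ‖fc W.2 k‖^2 := by
    intro k
    have e : Vc s W k - Vc t W k = ((Real.cos (omg k * s) - Real.cos (omg k * t) : ℝ) : ℂ) * fc W.1 k
        + ((snc (omg k) s - snc (omg k) t : ℝ) : ℂ) * fc W.2 k := by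
      unfold Vc; push_cast; ring
    have h := norm_add_sq_le (((Real.cos (omg k * s) - Real.cos (omg k * t) : ℝ) : ℂ) * fc W.1 k)
      (((snc (omg k) s - snc (omg k) t : ℝ) : ℂ) * fc W.2 k)
    rw [norm_mul, norm_mul, Complex.norm_real, Complex.norm_real, Real.norm_eq_abs, Real.norm_eq_abs] at h
    rw [e]
    have h1 := cos_lip (omg k) s t
    rw [abs_of_nonneg (omg_nonneg k)] at h1
    have h2 := snc_lip (omg k) s t
    have h3 := omg_le k
    have hj := jb_pos k
    have hp := Real.pi_pos
    have hcv := CV_ge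
    calc _ ≤ _ := h
      _ ≤ 2 * ((2 * Real.pi * jb k * |s - t|) * ‖fc W.1 k‖)^2 + 2 * (|s - t| * ‖fc W.2 k‖)^2 := by
          gcongr
          exact h1.trans (by gcongr)
      _ = CV * |s-t|^2 * (jb k^2 * ‖fc W.1 k‖^2) + 2 * |s-t|^2 * ‖fc W.2 k‖^2 := by
          unfold CV; ring
      _ ≤ CV * |s-t|^2 * (jb k^2 * ‖fc W.1 k‖^2) + CV * |s-t|^2 * ‖fc W.2 k‖^2 := by gcongr
      _ = _ := by rw [sq_abs]
  have hn : Summable fun k => ‖Vc s W k - Vc t W k‖^2 :=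
    Summable.of_nonneg_of_le (fun _ => by positivity) hle hs
  refine (hn.tsum_le_tsum hle hs).trans ?_
  rw [(hW.s1.mul_left _).tsum_add (hW.s2.mul_left _), tsum_mul_left, tsum_mul_left, ← mul_add]
  have hcv := CV_ge
  apply mul_le_mul_of_nonneg_left hW.le (by positivity)

lemma ser_sub {c d : KK → ℂ} (hc : Summable c) (hd : Summable d) (x : Pt 1) :
    ser (fun k => c k - d k) x = ser c x - ser d x := by
  unfold ser
  rw [← (ser_summable hc x).tsum_sub (ser_summable hd x)]
  congr 1; ext k; ring

lemma ser_diff_L2 {c d : KK → ℂ} (hc : Summable c) (hd : Summable d) :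
    ∫ x, ((ser c x).re - (ser d x).re)^2 ∂mu ≤ ∑' k, ‖c k - d k‖^2 := by
  have := parseval_le (hc.sub hd)
  simp only [ser_sub hc hd, Complex.sub_re] at this
  exact this

lemma re_ser_cont {c : KK → ℂ} (hc : Summable c) : Continuous fun x => (ser c x).re :=
  Complex.continuous_re.comp (ser_cont hc)

lemma expL_cont {W : Pair 1} {N : ℝ} (hW : Reg W N) (t : ℝ) : Continuous (expL t W).1 :=
  re_ser_cont (Vc_summable hW t)

lemma expL_diff_L2 {W : Pair 1} {N : ℝ} (hW : Reg W N) (s t : ℝ) :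
    ∫ x, ((expL s W).1 x - (expL t W).1 x)^2 ∂mu ≤ CV * (s - t)^2 * N^2 :=
  (ser_diff_L2 (Vc_summable hW s) (Vc_summable hW t)).trans (Vc_diff hW s t)

/-- Fourier coefficients of `f ∘ w` depend Lipschitz continuously on `w` in `L²`. -/
lemma fc_comp_diff {f : ℝ → ℝ} {L : ℝ} (hfc : Continuous f)
    (hfL : ∀ x y, |f x - f y| ≤ L * |x - y|) {w v : Fn 1} (hw : Continuous w) (hv : Continuous v) :
    ∫ x, (f (w x) - f (v x))^2 ∂mu ≤ L^2 * ∫ x, (w x - v x)^2 ∂mu := by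
  rw [← integral_const_mul]
  apply integral_mono
  · exact cont_int (((hfc.comp hw).sub (hfc.comp hv)).pow 2)
  · exact cont_int (continuous_const.mul ((hw.sub hv).pow 2))
  · intro x
    have h := hfL (w x) (v x)
    have h2 : |f (w x) - f (v x)|^2 ≤ (L * |w x - v x|)^2 := by gcongr
    rw [sq_abs, mul_pow, sq_abs] at h2
    exact h2

lemma fc_comp_lip {f : ℝ → ℝ} {L : ℝ} (hfc : Continuous f)
    (hfL : ∀ x y, |f x - f y| ≤ L * |x - y|) {w v : Fn 1} (hw : Continuous w) (hv : Continuous v)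
    (k : KK) :
    ‖fc (fun x => f (w x)) k - fc (fun x => f (v x)) k‖^2 ≤ L^2 * ∫ x, (w x - v x)^2 ∂mu := by
  have h := bessel_fin (w := fun x => f (w x) - f (v x)) ((hfc.comp hw).sub (hfc.comp hv)) {k}
  rw [Finset.sum_singleton, fc_sub (w := fun x => f (w x)) (v := fun x => f (v x))
    (hfc.comp hw) (hfc.comp hv)] at h
  exact h.trans (fc_comp_diff hfc hfL hw hv)

/-! ### The mild solution in Fourier space -/

structure Ctx (f : ℝ → ℝ) (L T B : ℝ) (U : ℝ → Pair 1) : Prop where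
  fcont : Continuous f
  fL : ∀ x y, |f x - f y| ≤ L * |x - y|
  mild : IsMild f T U
  reg : ∀ t ∈ Set.Icc (0:ℝ) T, Reg (U t) B
  hT : 0 < T
  hB : 1 ≤ B

noncomputable def gk (f : ℝ → ℝ) (U : ℝ → Pair 1) (t : ℝ) (k : KK) : ℂ :=
  fc (fun x => f ((U t).1 x)) k

noncomputable def clampT (T t : ℝ) : ℝ := max 0 (min T t)

lemma clampT_mem {T : ℝ} (hT : 0 < T) (t : ℝ) : clampT T t ∈ Set.Icc (0:ℝ) T := by
  unfold clampT; constructor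
  · exact le_max_left _ _
  · exact max_le hT.le (min_le_left _ _)

lemma clampT_eq {T t : ℝ} (ht : t ∈ Set.Icc (0:ℝ) T) : clampT T t = t := by
  unfold clampT; rw [min_eq_right ht.2, max_eq_right ht.1]

lemma clampT_cont (T : ℝ) : Continuous (clampT T) := by unfold clampT; fun_prop

noncomputable def Af (f : ℝ → ℝ) (L : ℝ) : ℝ := 2 * (f 0)^2 + 2 * L^2

lemma Af_nonneg (f : ℝ → ℝ) (L : ℝ) : 0 ≤ Af f L := by unfold Af; positivity

lemma fL2 {f : ℝ → ℝ} {L N : ℝ} (hfc : Continuous f)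
    (hfL : ∀ x y, |f x - f y| ≤ L * |x - y|) (hN : 1 ≤ N) {W : Pair 1} (hW : Reg W N)
    (hWe : W.1 = fun x => (ser (fc W.1) x).re) :
    ∫ x, (f (W.1 x))^2 ∂mu ≤ Af f L * N^2 := by
  have hsum := (l1_of_weighted hW.s1).1
  have hcw : Continuous W.1 := by rw [hWe]; exact re_ser_cont hsum
  have h1 : ∫ x, (W.1 x)^2 ∂mu ≤ N^2 := by
    have hp := parseval_le hsum
    have e : ∫ x, (W.1 x)^2 ∂mu = ∫ x, (ser (fc W.1) x).re^2 ∂mu := by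
      congr 1; ext x; rw [congrFun hWe x]
    rw [e]
    refine hp.trans ?_
    have h2 : ∑' k, ‖fc W.1 k‖^2 ≤ ∑' k, jb k^2 * ‖fc W.1 k‖^2 := by
      apply (summable_sq hsum).tsum_le_tsum _ hW.s1
      intro k
      have := jb_one k
      have : 1 ≤ jb k^2 := by nlinarith
      nlinarith [sq_nonneg ‖fc W.1 k‖]
    have h3 : 0 ≤ ∑' k, ‖fc W.2 k‖^2 := tsum_nonneg fun _ => by positivity
    linarith [hW.le]
  have h2 : ∫ x, (f (W.1 x))^2 ∂mu ≤ ∫ x, (2 * (f 0)^2 + 2 * L^2 * (W.1 x)^2) ∂mu := by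
    apply integral_mono
    · exact cont_int ((hfc.comp hcw).pow 2)
    · exact (integrable_const _).add (cont_int (continuous_const.mul (hcw.pow 2)))
    · intro x
      have h := hfL (W.1 x) 0
      rw [sub_zero] at h
      have h2 : |f (W.1 x) - f 0|^2 ≤ (L * |W.1 x|)^2 := by gcongr
      rw [sq_abs, mul_pow, sq_abs] at h2
      simp only
      nlinarith [sq_nonneg (f (W.1 x) - f 0 - f 0)]
  have hi : Integrable (fun x => 2 * L^2 * (W.1 x)^2) mu := cont_int (continuous_const.mul (hcw.pow 2))
  rw [integral_add (integrable_const _) hi, integral_const_mul (2 * L^2)] at h2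
  simp only [integral_const, probReal_univ, smul_eq_mul, one_mul] at h2
  refine h2.trans ?_
  unfold Af
  have : 1 ≤ N^2 := by nlinarith
  nlinarith [sq_nonneg (f 0), sq_nonneg L]

section dyn
variable {f : ℝ → ℝ} {L T B : ℝ} {U : ℝ → Pair 1}

lemma Ctx.u_eq (h : Ctx f L T B U) {t : ℝ} (ht : t ∈ Set.Icc (0:ℝ) T) :
    (U t).1 = fun x => (ser (fc (U t).1) x).re := by
  have hm := h.mild t 0 ht.1 le_rfl (by linarith [ht.2])
  rw [add_zero] at hm
  have h1 := congrArg Prod.fst hm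
  ext x
  have h2 := congrFun h1 x
  have e : Vc 0 (U t) = fc (U t).1 := by
    ext k; simp [Vc, snc_zero]
  have h3 : (U t).1 x = (expL 0 (U t)).1 x := by
    rw [h2]; simp [pInt]
  rw [h3, expL_fst, e]

lemma Ctx.a_sum (h : Ctx f L T B U) {t : ℝ} (ht : t ∈ Set.Icc (0:ℝ) T) : Summable (fc (U t).1) :=
  (l1_of_weighted (h.reg t ht).s1).1

lemma Ctx.u_cont (h : Ctx f L T B U) {t : ℝ} (ht : t ∈ Set.Icc (0:ℝ) T) : Continuous (U t).1 := by
  rw [h.u_eq ht]; exact re_ser_cont (h.a_sum ht)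

lemma Ctx.g_sq (h : Ctx f L T B U) {t N : ℝ} (ht : t ∈ Set.Icc (0:ℝ) T) (hN : 1 ≤ N)
    (hR : Reg (U t) N) :
    Summable (fun k => ‖gk f U t k‖^2) ∧ ∑' k, ‖gk f U t k‖^2 ≤ Af f L * N^2 := by
  have hc : Continuous fun x => f ((U t).1 x) := h.fcont.comp (h.u_cont ht)
  exact ⟨bessel_summable hc, (bessel hc).trans (fL2 h.fcont h.fL hN hR (h.u_eq ht))⟩

/-- coefficients of the Duhamel integrand, first component -/
noncomputable def Dc (s : ℝ) (g : KK → ℂ) (k : KK) : ℂ := ((snc (omg k) s : ℝ) : ℂ) * g k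

lemma Dc_weighted (s : ℝ) {g : KK → ℂ} {G : ℝ} (hg : Summable fun k => ‖g k‖^2)
    (hG : ∑' k, ‖g k‖^2 ≤ G) :
    Summable (fun k => jb k^2 * ‖Dc s g k‖^2) ∧
      ∑' k, jb k^2 * ‖Dc s g k‖^2 ≤ (1 + |s|)^2 * G := by
  have hle : ∀ k, jb k^2 * ‖Dc s g k‖^2 ≤ (1 + |s|)^2 * ‖g k‖^2 := by
    intro k
    unfold Dc
    rw [norm_mul, Complex.norm_real, Real.norm_eq_abs, ← mul_pow, ← mul_assoc, mul_pow]
    have := snc_jb k s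
    have := jb_pos k
    gcongr
  have hs := Summable.of_nonneg_of_le (fun k => by positivity) hle (hg.mul_left _)
  refine ⟨hs, (hs.tsum_le_tsum hle (hg.mul_left _)).trans ?_⟩
  rw [tsum_mul_left]
  gcongr

lemma Dc_sq (s : ℝ) {g : KK → ℂ} {G : ℝ} (hg : Summable fun k => ‖g k‖^2)
    (hG : ∑' k, ‖g k‖^2 ≤ G) :
    ∑' k, ‖Dc s g k‖^2 ≤ (1 + |s|)^2 * G := by
  obtain ⟨h1, h2⟩ := Dc_weighted s hg hG
  refine le_trans ((summable_sq (l1_of_weighted h1).1).tsum_le_tsum ?_ h1) h2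
  intro k
  have := jb_one k
  have : 1 ≤ jb k^2 := by nlinarith
  nlinarith [sq_nonneg ‖Dc s g k‖]

lemma Dc_sym (s : ℝ) {g : KK → ℂ} (hg : Sym g) : Sym (Dc s g) := by
  intro k; unfold Dc; rw [omg_neg, hg k]; simp

lemma Vc_zero_left (s : ℝ) (w : Fn 1) : Vc s ((fun _ => 0, w) : Pair 1) = Dc s (fc w) := by
  ext k; simp [Vc, Dc, fc_zero]

lemma Ctx.mild_fst (h : Ctx f L T B U) {t s : ℝ} (ht : 0 ≤ t) (hs : 0 ≤ s) (hts : t + s ≤ T)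
    (x : Pt 1) : (U (t+s)).1 x = (ser (Vc s (U t)) x).re
      + ∫ σ in (0:ℝ)..s, (ser (Dc (s - σ) (gk f U (t + σ))) x).re := by
  have h1 := congrFun (congrArg Prod.fst (h.mild t s ht hs hts)) x
  rw [h1]
  change (expL s (U t)).1 x + ∫ σ in (0:ℝ)..s, (expL (s-σ) (Fnl f (U (t + σ)))).1 x = _
  rw [expL_fst]
  congr 1
  apply intervalIntegral.integral_congr
  intro σ _
  simp only [expL_fst, Fnl, Vc_zero_left]
  rfl

noncomputable def MD (f : ℝ → ℝ) (L T B : ℝ) : ℝ := Zc + (1 + T)^2 * (Af f L * B^2)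

lemma Ctx.duh_le (h : Ctx f L T B U) {t s : ℝ} (ht : 0 ≤ t) (hs : 0 ≤ s) (hts : t + s ≤ T)
    (x : Pt 1) : |(U (t+s)).1 x - (expL s (U t)).1 x| ≤ MD f L T B * s := by
  rw [h.mild_fst ht hs hts, expL_fst, add_sub_cancel_left, ← Real.norm_eq_abs]
  have hMs : MD f L T B * s = MD f L T B * |s - 0| := by rw [sub_zero, abs_of_nonneg hs]
  rw [hMs]
  apply intervalIntegral.norm_integral_le_of_norm_le_const
  intro σ hσ
  rw [Set.uIoc_of_le hs] at hσ
  have htσ : t + σ ∈ Set.Icc 0 T := ⟨by linarith [hσ.1], by linarith [hσ.2]⟩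
  obtain ⟨g1, g2⟩ := h.g_sq htσ h.hB (h.reg _ htσ)
  obtain ⟨d1, d2⟩ := Dc_weighted (s - σ) g1 g2
  obtain ⟨e1, e2⟩ := l1_of_weighted d1
  rw [Real.norm_eq_abs]
  refine (Complex.abs_re_le_norm _).trans ((ser_norm e1 x).trans (e2.trans ?_))
  unfold MD
  have hab : |s - σ| ≤ T := by rw [abs_of_nonneg (by linarith [hσ.2])]; linarith [hσ.1]
  have hA := Af_nonneg f L
  refine add_le_add le_rfl (d2.trans ?_)
  gcongr

noncomputable def CL (f : ℝ → ℝ) (L T B : ℝ) : ℝ := 2 * (MD f L T B)^2 + 2 * (CV * B^2)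

lemma Ctx.u_lip (h : Ctx f L T B U) {t s : ℝ} (ht : 0 ≤ t) (hs : 0 ≤ s) (hts : t + s ≤ T) :
    ∫ x, ((U (t+s)).1 x - (U t).1 x)^2 ∂mu ≤ CL f L T B * s^2 := by
  have ht' : t ∈ Set.Icc 0 T := ⟨ht, by linarith⟩
  have hts' : t + s ∈ Set.Icc 0 T := ⟨by linarith, hts⟩
  have hR := h.reg t ht'
  have h0 : ∀ x, (expL 0 (U t)).1 x = (U t).1 x := by
    intro x
    have e : Vc 0 (U t) = fc (U t).1 := by ext k; simp [Vc, snc_zero]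
    rw [expL_fst, e, ← congrFun (h.u_eq ht') x]
  have h1 := expL_diff_L2 hR s 0
  simp only [h0, sub_zero] at h1
  have hc1 : Continuous fun x => (expL s (U t)).1 x - (U t).1 x :=
    (expL_cont hR s).sub (h.u_cont ht')
  have hi : Integrable (fun x => 2 * ((expL s (U t)).1 x - (U t).1 x)^2) mu :=
    cont_int (continuous_const.mul (hc1.pow 2))
  have h2 : ∫ x, ((U (t+s)).1 x - (U t).1 x)^2 ∂mu
      ≤ ∫ x, (2 * (MD f L T B * s)^2 + 2 * ((expL s (U t)).1 x - (U t).1 x)^2) ∂mu := by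
    apply integral_mono
    · exact cont_int (((h.u_cont hts').sub (h.u_cont ht')).pow 2)
    · exact (integrable_const _).add hi
    · intro x
      have hd := h.duh_le ht hs hts x
      have hd2 : |(U (t+s)).1 x - (expL s (U t)).1 x|^2 ≤ (MD f L T B * s)^2 := by gcongr
      rw [sq_abs] at hd2
      simp only
      nlinarith [sq_nonneg ((U (t+s)).1 x - (expL s (U t)).1 x - ((expL s (U t)).1 x - (U t).1 x))]
  rw [integral_add (integrable_const _) hi,
    integral_const_mul 2 (fun x => ((expL s (U t)).1 x - (U t).1 x)^2)] at h2
  simp only [integral_const, probReal_univ, smul_eq_mul, one_mul] at h2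
  unfold CL
  nlinarith

lemma Ctx.g_lip (h : Ctx f L T B U) (k : KK) {t s : ℝ} (ht : t ∈ Set.Icc 0 T)
    (hs : s ∈ Set.Icc 0 T) : ‖gk f U s k - gk f U t k‖ ≤ √(L^2 * CL f L T B) * |s - t| := by
  wlog hle : t ≤ s generalizing t s
  · rw [norm_sub_rev, abs_sub_comm]
    exact this hs ht (by linarith)
  have h1 := fc_comp_lip h.fcont h.fL (h.u_cont hs) (h.u_cont ht) k
  have h2 := h.u_lip ht.1 (sub_nonneg.2 hle) (by linarith [hs.2])
  rw [add_sub_cancel] at h2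
  have h3 : ‖gk f U s k - gk f U t k‖^2 ≤ (L^2 * CL f L T B) * |s-t|^2 := by
    rw [sq_abs, mul_assoc]
    refine h1.trans ?_
    gcongr
  have hcv := CV_ge
  rw [← Real.sqrt_sq (abs_nonneg (s-t)), ← Real.sqrt_mul (by unfold CL; positivity)]
  exact Real.le_sqrt_of_sq_le h3

/-- time-clamped nonlinearity -/
noncomputable def gT (f : ℝ → ℝ) (T : ℝ) (U : ℝ → Pair 1) (t : ℝ) (k : KK) : ℂ :=
  gk f U (clampT T t) k

lemma Ctx.gT_cont (h : Ctx f L T B U) (k : KK) : Continuous fun t => gT f T U t k := by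
  have h1 : ContinuousOn (fun t => gk f U t k) (Set.Icc 0 T) := by
    have : LipschitzOnWith (Real.toNNReal √(L^2 * CL f L T B)) (fun t => gk f U t k) (Set.Icc 0 T) := by
      apply LipschitzOnWith.of_dist_le_mul
      intro s hs t ht
      rw [dist_eq_norm, Real.dist_eq, Real.coe_toNNReal _ (Real.sqrt_nonneg _)]
      exact h.g_lip k ht hs
    exact this.continuousOn
  exact h1.comp_continuous (clampT_cont T) (clampT_mem h.hT)

lemma Ctx.gT_sym (t : ℝ) : Sym (gT f T U t) := fc_sym _

lemma gT_eq {t : ℝ} (ht : t ∈ Set.Icc 0 T) : gT f T U t = gk f U t := by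
  ext k; unfold gT; rw [clampT_eq ht]

/-- the first component of the Duhamel formula in Fourier space -/
lemma Ctx.a_evol (h : Ctx f L T B U) {t s : ℝ} (ht : 0 ≤ t) (hs : 0 ≤ s) (hts : t + s ≤ T) (k : KK) :
    fc (U (t+s)).1 k = Vc s (U t) k
      + ∫ σ in (0:ℝ)..s, ((snc (omg k) (s - σ) : ℝ) : ℂ) * gT f T U (t + σ) k := by
  have ht' : t ∈ Set.Icc 0 T := ⟨ht, by linarith⟩
  have hts' : t + s ∈ Set.Icc 0 T := ⟨by linarith, hts⟩
  have hR := h.reg t ht'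
  have hV := Vc_summable hR s
  set c : ℝ → KK → ℂ := fun σ => Dc (s - σ) (gT f T U (t + σ)) with hc
  have hmem : ∀ σ ∈ Set.Icc 0 s, t + σ ∈ Set.Icc 0 T := fun σ hσ =>
    ⟨by linarith [hσ.1], by linarith [hσ.2]⟩
  have hfun : (fun x => ∫ σ in (0:ℝ)..s, (ser (c σ) x).re)
      = fun x => (U (t+s)).1 x - (ser (Vc s (U t)) x).re := by
    ext x
    rw [h.mild_fst ht hs hts, add_sub_cancel_left]
    apply intervalIntegral.integral_congr
    intro σ hσ
    rw [Set.uIcc_of_le hs] at hσ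
    simp only [hc]
    rw [gT_eq (hmem σ hσ)]
  have hcc : ∀ k, Continuous fun σ => c σ k := by
    intro k
    simp only [hc, Dc]
    apply Continuous.mul
    · exact Complex.continuous_ofReal.comp ((snc_cont _).comp (by fun_prop))
    · exact (h.gT_cont k).comp (by fun_prop)
  have hA := Af_nonneg f L
  have hg : ∀ σ, Summable (fun k => ‖gT f T U σ k‖^2) ∧ ∑' k, ‖gT f T U σ k‖^2 ≤ Af f L * B^2 :=
    fun σ => h.g_sq (clampT_mem h.hT σ) h.hB (h.reg _ (clampT_mem h.hT σ))
  have hF := fubini_eq hcc hs (M := (1+s)^2 * (Af f L * B^2)) (by positivity)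
    (fun σ hσ => by
      refine (Dc_sq (s-σ) (hg (t+σ)).1 (hg (t+σ)).2).trans ?_
      have : |s - σ| ≤ s := by rw [abs_of_nonneg (by linarith [hσ.2])]; linarith [hσ.1]
      gcongr)
    (fun σ => Dc_sym _ (Ctx.gT_sym _))
    (fun σ hσ => (l1_of_weighted (Dc_weighted (s-σ) (hg (t+σ)).1 (hg (t+σ)).2).1).1) k
  rw [hfun, fc_sub (h.u_cont hts') (re_ser_cont hV), fc_ser (Vc_sym _ _) hV] at hF
  exact sub_eq_iff_eq_add'.1 hF

noncomputable def Pf (f : ℝ → ℝ) (T : ℝ) (U : ℝ → Pair 1) (k : KK) (t s : ℝ) : ℂ :=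
  fc (U t).1 k - ∫ σ in (0:ℝ)..s, ((snc (omg k) σ : ℝ) : ℂ) * gT f T U (t + σ) k

noncomputable def Qf (f : ℝ → ℝ) (T : ℝ) (U : ℝ → Pair 1) (k : KK) (t s : ℝ) : ℂ :=
  fc (U t).2 k + ∫ σ in (0:ℝ)..s, ((Real.cos (omg k * σ) : ℝ) : ℂ) * gT f T U (t + σ) k

noncomputable def Phi (f : ℝ → ℝ) (T : ℝ) (U : ℝ → Pair 1) (k : KK) (t s : ℝ) : ℂ :=
  ((Real.cos (omg k * s) : ℝ) : ℂ) * Pf f T U k t s + ((snc (omg k) s : ℝ) : ℂ) * Qf f T U k t s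

noncomputable def Psi (f : ℝ → ℝ) (T : ℝ) (U : ℝ → Pair 1) (k : KK) (t s : ℝ) : ℂ :=
  ((-(omg k * Real.sin (omg k * s)) : ℝ) : ℂ) * Pf f T U k t s
    + ((Real.cos (omg k * s) : ℝ) : ℂ) * Qf f T U k t s

lemma Ctx.sg_cont (h : Ctx f L T B U) (k : KK) (t : ℝ) :
    Continuous fun σ => ((snc (omg k) σ : ℝ) : ℂ) * gT f T U (t + σ) k :=
  (Complex.continuous_ofReal.comp (snc_cont _)).mul ((h.gT_cont k).comp (by fun_prop))

lemma Ctx.cg_cont (h : Ctx f L T B U) (k : KK) (t : ℝ) :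
    Continuous fun σ => ((Real.cos (omg k * σ) : ℝ) : ℂ) * gT f T U (t + σ) k :=
  (Complex.continuous_ofReal.comp (by fun_prop)).mul ((h.gT_cont k).comp (by fun_prop))

lemma Ctx.a_phi (h : Ctx f L T B U) {t s : ℝ} (ht : 0 ≤ t) (hs : 0 ≤ s) (hts : t + s ≤ T) (k : KK) :
    fc (U (t+s)).1 k = Phi f T U k t s := by
  rw [h.a_evol ht hs hts]
  unfold Vc Phi Pf Qf
  have e : ∀ σ, ((snc (omg k) (s - σ) : ℝ) : ℂ) * gT f T U (t + σ) k
      = ((snc (omg k) s : ℝ) : ℂ) * (((Real.cos (omg k * σ) : ℝ) : ℂ) * gT f T U (t + σ) k)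
        - ((Real.cos (omg k * s) : ℝ) : ℂ) * (((snc (omg k) σ : ℝ) : ℂ) * gT f T U (t + σ) k) := by
    intro σ; rw [snc_sub]; push_cast; ring
  simp_rw [e]
  rw [intervalIntegral.integral_sub, intervalIntegral.integral_const_mul,
    intervalIntegral.integral_const_mul]
  · ring
  · exact (continuous_const.mul (h.cg_cont k t)).intervalIntegrable _ _
  · exact (continuous_const.mul (h.sg_cont k t)).intervalIntegrable _ _

lemma Ctx.phi_deriv (h : Ctx f L T B U) (k : KK) (t s : ℝ) :
    HasDerivAt (Phi f T U k t) (Psi f T U k t s) s := by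
  have hP : HasDerivAt (Pf f T U k t) (-(((snc (omg k) s : ℝ) : ℂ) * gT f T U (t + s) k)) s := by
    have := ((h.sg_cont k t).integral_hasStrictDerivAt 0 s).hasDerivAt
    exact this.const_sub _
  have hQ : HasDerivAt (Qf f T U k t) (((Real.cos (omg k * s) : ℝ) : ℂ) * gT f T U (t + s) k) s := by
    have := ((h.cg_cont k t).integral_hasStrictDerivAt 0 s).hasDerivAt
    exact this.const_add _
  have h1 : HasDerivAt (fun t => omg k * t) (omg k) s := by
    simpa using (hasDerivAt_id s).const_mul (omg k)
  have hcos := (h1.cos).ofReal_comp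
  have hsin := (snc_deriv (omg k) s).ofReal_comp
  have := (hcos.mul hP).add (hsin.mul hQ)
  refine this.congr_deriv ?_
  unfold Psi; push_cast; ring

lemma Ctx.b_psi (h : Ctx f L T B U) {t s : ℝ} (ht : 0 ≤ t) (hs : 0 ≤ s) (hts : t + s < T) (k : KK) :
    fc (U (t+s)).2 k = Psi f T U k t s := by
  have h1 : HasDerivAt (fun y => Phi f T U k t (s + y)) (Psi f T U k t s) 0 := by
    apply HasDerivAt.comp_const_add
    simpa using h.phi_deriv k t s
  have h2 := h.phi_deriv k (t+s) 0
  have e0 : Psi f T U k (t+s) 0 = fc (U (t+s)).2 k := by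
    simp [Psi, Pf, Qf]
  rw [e0] at h2
  have hev : (fun y => Phi f T U k t (s + y)) =ᶠ[nhdsWithin 0 (Set.Ici 0)] Phi f T U k (t+s) := by
    have : Set.Ico (0:ℝ) (T - (t+s)) ∈ nhdsWithin (0:ℝ) (Set.Ici 0) :=
      Ico_mem_nhdsGE (by linarith)
    filter_upwards [this] with y hy
    rw [← h.a_phi ht (by linarith [hy.1]) (by linarith [hy.2]),
      ← h.a_phi (by linarith) hy.1 (by linarith [hy.2]), add_assoc]
  have h3 : HasDerivWithinAt (fun y => Phi f T U k t (s + y)) (fc (U (t+s)).2 k) (Set.Ici 0) 0 := by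
    apply h2.hasDerivWithinAt.congr_of_eventuallyEq hev
    exact hev.self_of_nhdsWithin (by simp)
  exact (uniqueDiffWithinAt_Ici (0:ℝ)).eq_deriv _ h3 h1.hasDerivWithinAt

/-- backward evolution -/
lemma Ctx.a_back (h : Ctx f L T B U) {t s : ℝ} (ht : 0 ≤ t) (hs : 0 ≤ s) (hts : t + s < T) (k : KK) :
    fc (U t).1 k - Vc (-s) (U (t+s)) k
      = ∫ σ in (0:ℝ)..s, ((snc (omg k) σ : ℝ) : ℂ) * gT f T U (t + σ) k := by
  have hv : Vc (-s) (U (t+s)) k = Pf f T U k t s := by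
    unfold Vc
    rw [h.a_phi ht hs hts.le, h.b_psi ht hs hts, snc_neg]
    unfold Phi Psi
    have := congrArg (fun x : ℝ => (x : ℂ)) (snc_pyth (omg k) s)
    simp only [mul_neg, Real.cos_neg]
    push_cast at this ⊢
    linear_combination (Pf f T U k t s) * this
  rw [hv]; unfold Pf; ring

end dyn

/-! ### The remainder estimate -/

section rem
variable {f : ℝ → ℝ} {L T B : ℝ} {U : ℝ → Pair 1}

lemma duh_sq {G : ℝ → KK → ℂ} (hG : ∀ k, Continuous fun σ => G σ k) {ρ : KK → ℝ → ℝ}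
    (hρc : ∀ k, Continuous (ρ k)) {s Q : ℝ} (hs : 0 ≤ s)
    (hρ : ∀ k, ∀ σ ∈ Set.Icc 0 s, |ρ k σ| ≤ s)
    (hGs : ∀ σ ∈ Set.Icc 0 s, Summable fun k => ‖G σ k‖^2)
    (hGQ : ∀ σ ∈ Set.Icc 0 s, ∑' k, ‖G σ k‖^2 ≤ Q) (F : Finset KK) :
    ∑ k ∈ F, ‖∫ σ in (0:ℝ)..s, ((ρ k σ : ℝ) : ℂ) * G σ k‖^2 ≤ s^4 * Q := by
  have := mink F (φ := fun σ k => ((ρ k σ : ℝ) : ℂ) * G σ k)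
    (fun k => (Complex.continuous_ofReal.comp (hρc k)).mul (hG k)) hs (Q := s^2 * Q) (by
      intro σ hσ
      calc ∑ k ∈ F, ‖((ρ k σ : ℝ) : ℂ) * G σ k‖^2 ≤ ∑ k ∈ F, s^2 * ‖G σ k‖^2 := by
            apply Finset.sum_le_sum
            intro k _
            rw [norm_mul, Complex.norm_real, Real.norm_eq_abs, mul_pow]
            have := hρ k σ hσ
            gcongr
        _ = s^2 * ∑ k ∈ F, ‖G σ k‖^2 := by rw [Finset.mul_sum]
        _ ≤ s^2 * Q := by
            gcongr
            exact ((hGs σ hσ).sum_le_tsum F fun _ _ => by positivity).trans (hGQ σ hσ))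
  refine this.trans (le_of_eq ?_)
  ring

lemma Ctx.D_bound (h : Ctx f L T B U) {N τ t0 : ℝ} (hN : 1 ≤ N) (hτ : 0 < τ) (h0 : 0 ≤ t0 - τ)
    (h1 : t0 + τ ≤ T) (hR : ∀ t ∈ Set.Icc (t0 - τ) (t0 + τ), Reg (U t) N)
    {s : ℝ} (hs : s ∈ Set.Icc (-τ) τ) :
    ∫ x, ((U (t0+s)).1 x - (expL s (U t0)).1 x)^2 ∂mu ≤ τ^4 * (Af f L * N^2) := by
  have ht0 : t0 ∈ Set.Icc 0 T := ⟨by linarith, by linarith⟩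
  have hts : t0 + s ∈ Set.Icc 0 T := ⟨by linarith [hs.1], by linarith [hs.2]⟩
  have hA := Af_nonneg f L
  have hg : ∀ t ∈ Set.Icc (t0 - τ) (t0 + τ),
      Summable (fun k => ‖gT f T U t k‖^2) ∧ ∑' k, ‖gT f T U t k‖^2 ≤ Af f L * N^2 := by
    intro t ht
    have ht' : t ∈ Set.Icc 0 T := ⟨by linarith [ht.1], by linarith [ht.2]⟩
    rw [gT_eq ht']
    exact h.g_sq ht' hN (hR t ht)
  have hV := Vc_summable (h.reg t0 ht0) s
  have e : ∀ x, (U (t0+s)).1 x - (expL s (U t0)).1 x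
      = (ser (fc (U (t0+s)).1) x).re - (ser (Vc s (U t0)) x).re := by
    intro x; rw [congrFun (h.u_eq hts) x, expL_fst]
  simp_rw [e]
  refine (ser_diff_L2 (h.a_sum hts) hV).trans ?_
  apply (summable_sq ((h.a_sum hts).sub hV)).tsum_le_of_sum_le
  intro F
  rcases le_total 0 s with hs0 | hs0
  · have e2 : ∀ k, fc (U (t0+s)).1 k - Vc s (U t0) k
        = ∫ σ in (0:ℝ)..s, ((snc (omg k) (s - σ) : ℝ) : ℂ) * gT f T U (t0 + σ) k := by
      intro k; rw [h.a_evol ht0.1 hs0 hts.2, add_sub_cancel_left]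
    simp_rw [e2]
    have := duh_sq (G := fun σ => gT f T U (t0 + σ)) (ρ := fun k σ => snc (omg k) (s - σ))
      (fun k => (h.gT_cont k).comp (by fun_prop)) (fun k => (snc_cont _).comp (by fun_prop))
      (Q := Af f L * N^2) hs0
      (by
        intro k σ hσ
        refine (snc_abs _ _).trans ?_
        rw [abs_of_nonneg (by linarith [hσ.2])]; linarith [hσ.1])
      (fun σ hσ => (hg (t0+σ) ⟨by linarith [hσ.1], by linarith [hσ.2, hs.2]⟩).1)
      (fun σ hσ => (hg (t0+σ) ⟨by linarith [hσ.1], by linarith [hσ.2, hs.2]⟩).2) F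
    refine this.trans ?_
    have := hs.2
    gcongr
  · obtain ⟨s, rfl⟩ : ∃ y, s = -y := ⟨-s, by ring⟩
    have hs0' : 0 ≤ s := by linarith
    have e2 : ∀ k, fc (U (t0+-s)).1 k - Vc (-s) (U t0) k
        = ∫ σ in (0:ℝ)..s, ((snc (omg k) σ : ℝ) : ℂ) * gT f T U (t0 + -s + σ) k := by
      intro k
      have := h.a_back (t := t0 + -s) (s := s) hts.1 hs0' (by linarith) k
      rw [← this]; congr 3; ring_nf
    simp_rw [e2]
    have hs1 : s ≤ τ := by linarith [hs.1]
    have := duh_sq (G := fun σ => gT f T U (t0 + -s + σ)) (ρ := fun k σ => snc (omg k) σ)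
      (fun k => (h.gT_cont k).comp (by fun_prop)) (fun k => (snc_cont _))
      (Q := Af f L * N^2) hs0'
      (by
        intro k σ hσ
        refine (snc_abs _ _).trans ?_
        rw [abs_of_nonneg hσ.1]; exact hσ.2)
      (fun σ hσ => (hg (t0+-s+σ) ⟨by linarith [hσ.1], by linarith [hσ.2]⟩).1)
      (fun σ hσ => (hg (t0+-s+σ) ⟨by linarith [hσ.1], by linarith [hσ.2]⟩).2) F
    refine this.trans ?_
    gcongr

noncomputable def pk (f : ℝ → ℝ) (W : Pair 1) (s : ℝ) (k : KK) : ℂ :=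
  fc (fun x => f ((expL s W).1 x)) k

lemma Ctx.pk_cont (h : Ctx f L T B U) {t0 : ℝ} (ht0 : t0 ∈ Set.Icc 0 T) (k : KK) :
    Continuous fun s => pk f (U t0) s k := by
  have hR := h.reg t0 ht0
  have hcv := CV_ge
  have : LipschitzWith (Real.toNNReal √(L^2 * (CV * B^2))) (fun s => pk f (U t0) s k) := by
    apply LipschitzWith.of_dist_le_mul
    intro s t
    rw [dist_eq_norm, Real.dist_eq, Real.coe_toNNReal _ (Real.sqrt_nonneg _)]
    have h1 := fc_comp_lip h.fcont h.fL (expL_cont hR s) (expL_cont hR t) k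
    have h2 := expL_diff_L2 hR s t
    rw [← Real.sqrt_sq (abs_nonneg (s-t)), ← Real.sqrt_mul (by positivity)]
    apply Real.le_sqrt_of_sq_le
    refine h1.trans ?_
    rw [sq_abs, mul_assoc]
    apply mul_le_mul_of_nonneg_left _ (sq_nonneg L)
    linarith
  exact this.continuous

lemma expL_snd_zero (t : ℝ) (w : Fn 1) (x : Pt 1) :
    (expL t ((fun _ => 0, w) : Pair 1)).2 x
      = (ser (fun k => ((Real.cos (omg k * t) : ℝ) : ℂ) * fc w k) x).re := by
  simp [expL, ser, fc_zero]

noncomputable def C0 (f : ℝ → ℝ) (L T : ℝ) : ℝ := ((1 + T)^2 + 1) * 4 * L^2 * Af f L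

lemma Ctx.core (h : Ctx f L T B U) {N τ t0 : ℝ} (hN : 1 ≤ N) (hτ : 0 < τ) (h0 : 0 ≤ t0 - τ)
    (h1 : t0 + τ ≤ T) (hR : ∀ t ∈ Set.Icc (t0 - τ) (t0 + τ), Reg (U t) N) :
    pnorm 1 (pInt (-τ) τ fun s =>
      expL (-s) (Fnl f (U (t0 + s)) - Fnl f (expL s (U t0)))) ^ 2 ≤ C0 f L T * τ^6 * N^2 := by
  have ht0 : t0 ∈ Set.Icc 0 T := ⟨by linarith, by linarith⟩
  have hab : -τ ≤ τ := by linarith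
  have hA := Af_nonneg f L
  have hTτ : τ ≤ T := by linarith
  set dT : ℝ → KK → ℂ := fun s k => gT f T U (t0 + s) k - pk f (U t0) s k with hdT
  have hdc : ∀ k, Continuous fun s => dT s k := fun k =>
    ((h.gT_cont k).comp (by fun_prop)).sub (h.pk_cont ht0 k)
  have hdsym : ∀ s, Sym (dT s) := by
    intro s k
    have e1 : gT f T U (t0 + s) (-k) = _ := Ctx.gT_sym (f := f) (T := T) (U := U) (t0+s) k
    have e2 : pk f (U t0) s (-k) = (starRingEnd ℂ) (pk f (U t0) s k) := fc_sym _ k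
    simp only [hdT, e1, e2, map_sub]
  have hmem : ∀ s ∈ Set.Icc (-τ) τ, t0 + s ∈ Set.Icc 0 T := fun s hs =>
    ⟨by linarith [hs.1], by linarith [hs.2]⟩
  have hdeq : ∀ s ∈ Set.Icc (-τ) τ,
      fc (fun x => f ((U (t0+s)).1 x) - f ((expL s (U t0)).1 x)) = dT s := by
    intro s hs
    ext k
    rw [fc_sub (w := fun x => f ((U (t0+s)).1 x)) (v := fun x => f ((expL s (U t0)).1 x))
      (h.fcont.comp (h.u_cont (hmem s hs))) (h.fcont.comp (expL_cont (h.reg t0 ht0) s))]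
    simp only [hdT]
    rw [gT_eq (hmem s hs)]
    rfl
  set Q : ℝ := L^2 * (τ^4 * (Af f L * N^2)) with hQ
  have hQ0 : 0 ≤ Q := by positivity
  have hdQ : ∀ s ∈ Set.Icc (-τ) τ, Summable (fun k => ‖dT s k‖^2) ∧ ∑' k, ‖dT s k‖^2 ≤ Q := by
    intro s hs
    rw [← hdeq s hs]
    have hcu := h.u_cont (hmem s hs)
    have hce := expL_cont (h.reg t0 ht0) s
    have hc : Continuous fun x => f ((U (t0+s)).1 x) - f ((expL s (U t0)).1 x) :=
      (h.fcont.comp hcu).sub (h.fcont.comp hce)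
    refine ⟨bessel_summable hc, (bessel hc).trans ((fc_comp_diff h.fcont h.fL hcu hce).trans ?_)⟩
    exact mul_le_mul_of_nonneg_left (h.D_bound hN hτ h0 h1 hR hs) (sq_nonneg L)
  have hW : ∀ s, Fnl f (U (t0 + s)) - Fnl f (expL s (U t0))
      = ((fun _ => 0, fun x => f ((U (t0+s)).1 x) - f ((expL s (U t0)).1 x)) : Pair 1) := by
    intro s
    ext x <;> simp [Fnl]
  simp_rw [hW]
  set c1 : ℝ → KK → ℂ := fun s => Dc (-s) (dT s) with hc1
  set c2 : ℝ → KK → ℂ := fun s k => ((Real.cos (omg k * (-s)) : ℝ) : ℂ) * dT s k with hc2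
  have hR1 : (pInt (-τ) τ fun s => expL (-s) ((fun _ => 0, fun x =>
      f ((U (t0+s)).1 x) - f ((expL s (U t0)).1 x)) : Pair 1)).1
      = fun x => ∫ s in (-τ)..τ, (ser (c1 s) x).re := by
    ext x
    apply intervalIntegral.integral_congr
    intro s hs
    rw [Set.uIcc_of_le hab] at hs
    change (ser (Vc (-s) ((fun _ => 0, fun x =>
      f ((U (t0+s)).1 x) - f ((expL s (U t0)).1 x)) : Pair 1)) x).re = (ser (Dc (-s) (dT s)) x).re
    rw [Vc_zero_left, hdeq s hs]
  have hR2 : (pInt (-τ) τ fun s => expL (-s) ((fun _ => 0, fun x =>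
      f ((U (t0+s)).1 x) - f ((expL s (U t0)).1 x)) : Pair 1)).2
      = fun x => ∫ s in (-τ)..τ, (ser (c2 s) x).re := by
    ext x
    apply intervalIntegral.integral_congr
    intro s hs
    rw [Set.uIcc_of_le hab] at hs
    simp only [expL_snd_zero, hdeq s hs, hc2]
  have habs : ∀ s ∈ Set.Icc (-τ) τ, |-s| ≤ T := by
    intro s hs; rw [abs_neg, abs_le]; exact ⟨by linarith [hs.1], by linarith [hs.2]⟩
  have hc1c : ∀ k, Continuous fun s => c1 s k := fun k =>
    (Complex.continuous_ofReal.comp ((snc_cont _).comp continuous_neg)).mul (hdc k)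
  have hc2c : ∀ k, Continuous fun s => c2 s k := fun k =>
    (Complex.continuous_ofReal.comp (by fun_prop)).mul (hdc k)
  have hc2le : ∀ s k, ‖c2 s k‖^2 ≤ ‖dT s k‖^2 := by
    intro s k
    simp only [hc2]
    rw [norm_mul, Complex.norm_real, Real.norm_eq_abs]
    have := Real.abs_cos_le_one (omg k * (-s))
    have h2 : |Real.cos (omg k * (-s))| * ‖dT s k‖ ≤ 1 * ‖dT s k‖ := by gcongr
    rw [one_mul] at h2
    gcongr
  have hc1Q : ∀ s ∈ Set.Icc (-τ) τ, (Summable fun k => jb k^2 * ‖c1 s k‖^2) ∧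
      ∑' k, jb k^2 * ‖c1 s k‖^2 ≤ (1+T)^2 * Q := by
    intro s hs
    obtain ⟨q1, q2⟩ := Dc_weighted (-s) (hdQ s hs).1 (hdQ s hs).2
    refine ⟨q1, q2.trans ?_⟩
    have := habs s hs
    gcongr
  -- first component
  have S1 : sob 1 (fun x => ∫ s in (-τ)..τ, (ser (c1 s) x).re) ^ 2 ≤ (τ - -τ)^2 * ((1+T)^2 * Q) := by
    rw [sob_sq]
    have hfin : ∀ F : Finset KK, ∑ k ∈ F, jb k ^ (2*(1:ℝ)) *
        ‖fc (fun x => ∫ s in (-τ)..τ, (ser (c1 s) x).re) k‖^2 ≤ (τ - -τ)^2 * ((1+T)^2 * Q) := by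
      intro F
      have hm := mink F (φ := fun s k => jb k * ‖c1 s k‖) (fun k => continuous_const.mul (hc1c k).norm)
        hab (Q := (1+T)^2 * Q) (by
          intro s hs
          obtain ⟨q1, q2⟩ := hc1Q s hs
          refine le_trans (le_of_eq ?_) ((q1.sum_le_tsum F fun _ _ => by positivity).trans q2)
          apply Finset.sum_congr rfl
          intro k _
          simp [mul_pow])
      refine le_trans (Finset.sum_le_sum ?_) hm
      intro k _
      have hk := fubini_le hc1c hab (M := (1+T)^2 * Q) (by positivity) (fun s hs => by
          refine (Dc_sq (-s) (hdQ s hs).1 (hdQ s hs).2).trans ?_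
          have := habs s hs
          gcongr) (fun s => Dc_sym _ (hdsym s)) k
      have hj := jb_pos k
      rw [intervalIntegral.integral_const_mul, norm_mul, mul_pow, Real.norm_of_nonneg hj.le]
      have e : jb k ^ (2*(1:ℝ)) = jb k^2 := by
        rw [mul_one]; exact_mod_cast Real.rpow_natCast (jb k) 2
      rw [e]
      have : ‖fc (fun x => ∫ s in (-τ)..τ, (ser (c1 s) x).re) k‖ ≤ ‖∫ s in (-τ)..τ, ‖c1 s k‖‖ :=
        hk.trans (Real.le_norm_self _)
      gcongr
    have hs := summable_of_sum_le (fun k => by have := jb_pos k; positivity) hfin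
    exact hs.tsum_le_of_sum_le hfin
  have S2 : sob (1-1) (fun x => ∫ s in (-τ)..τ, (ser (c2 s) x).re) ^ 2 ≤ (τ - -τ)^2 * Q := by
    rw [sob_sq]
    have hfin : ∀ F : Finset KK, ∑ k ∈ F, jb k ^ (2*(1-1:ℝ)) *
        ‖fc (fun x => ∫ s in (-τ)..τ, (ser (c2 s) x).re) k‖^2 ≤ (τ - -τ)^2 * Q := by
      intro F
      have hm := mink F (φ := fun s k => ‖c2 s k‖) (fun k => (hc2c k).norm)
        hab (Q := Q) (by
          intro s hs
          obtain ⟨q1, q2⟩ := hdQ s hs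
          refine le_trans (Finset.sum_le_sum ?_) ((q1.sum_le_tsum F fun _ _ => by positivity).trans q2)
          intro k _
          rw [norm_norm]; exact hc2le s k)
      refine le_trans (Finset.sum_le_sum ?_) hm
      intro k _
      have hk := fubini_le hc2c hab (M := Q) hQ0 (fun s hs => by
          obtain ⟨q1, q2⟩ := hdQ s hs
          exact ((Summable.of_nonneg_of_le (fun _ => by positivity) (hc2le s) q1).tsum_le_tsum
            (hc2le s) q1).trans q2)
          (fun s j => by
            simp only [hc2, omg_neg, hdsym s j, map_mul, Complex.conj_ofReal]) k
      have e : jb k ^ (2*(1-1:ℝ)) = 1 := by simp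
      rw [e, one_mul]
      have : ‖fc (fun x => ∫ s in (-τ)..τ, (ser (c2 s) x).re) k‖ ≤ ‖∫ s in (-τ)..τ, ‖c2 s k‖‖ :=
        hk.trans (Real.le_norm_self _)
      gcongr
    have hs := summable_of_sum_le (fun k => by have := jb_pos k; positivity) hfin
    exact hs.tsum_le_of_sum_le hfin
  rw [pnorm_sq, hR1, hR2]
  refine (add_le_add S1 S2).trans (le_of_eq ?_)
  rw [hQ]; unfold C0; ring

end rem

/-- **Bound on the remainder `R₁(tₙ)` (3.37).**
Let `0 ≤ r < 1`, let `U` be a mild solution of the Klein-Gordon system on `𝕋`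
with `U ∈ L^∞(0,T; H^{1+r}(𝕋) × H^r(𝕋))`, and set
`R₁(tₙ) := ∫_{-τ}^{τ} e^{-sL} [F(U(tₙ+s)) - F(e^{sL} U(tₙ))] ds`.  Then
`‖R₁(tₙ)‖₁ ≲ τ^{2+r} (1 + max_{s∈[-τ,τ]} ‖U(tₙ+s)‖_{1+r}
+ max_{s∈[-τ,τ]} ‖U(tₙ+s)‖₀)²`. -/
theorem R1_bound
    (f : ℝ → ℝ) (L : ℝ) (hf : ContDiff ℝ 2 f)
    (hf1 : ∀ x : ℝ, |deriv f x| ≤ L) (hf2 : ∀ x : ℝ, |deriv (deriv f) x| ≤ L)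
    (T : ℝ) (hT : 0 < T) (r : ℝ) (hr0 : 0 ≤ r) (hr1 : r < 1) :
    ∃ C > 0, ∀ τ : ℝ, 0 < τ → ∀ U : ℝ → Pair 1, IsMild f T U →
      (∀ t ∈ Set.Icc (0:ℝ) T, PMem (1+r) (U t)) →
      (∃ B : ℝ, ∀ t ∈ Set.Icc (0:ℝ) T, pnorm (1+r) (U t) ≤ B) →
      ∀ n : ℕ, 1 ≤ n → ((n : ℝ) + 1) * τ ≤ T →
      pnorm 1 (pInt (-τ) τ fun s =>
          expL (-s) (Fnl f (U ((n : ℝ) * τ + s)) - Fnl f (expL s (U ((n : ℝ) * τ)))))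
        ≤ C * τ ^ (2 + r) *
          (1 + (⨆ s ∈ Set.Icc (-τ) τ, pnorm (1+r) (U ((n : ℝ) * τ + s)))
             + (⨆ s ∈ Set.Icc (-τ) τ, pnorm 0 (U ((n : ℝ) * τ + s))))^2 := by
  have hL0 : 0 ≤ L := (abs_nonneg _).trans (hf1 0)
  have hfL : ∀ x y, |f x - f y| ≤ L * |x - y| := by
    intro x y
    have := Convex.norm_image_sub_le_of_norm_deriv_le (𝕜 := ℝ) (f := f) (s := Set.univ) (C := L)
      (x := y) (y := x) (fun z _ => (hf.differentiable (by norm_num)) z)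
      (fun z _ => by simpa using hf1 z) convex_univ (Set.mem_univ _) (Set.mem_univ _)
    simpa using this
  have hC0 : 0 ≤ C0 f L T := by
    have := Af_nonneg f L
    unfold C0; positivity
  refine ⟨√(C0 f L T) * T ^ (1 - r) + 1, by positivity, ?_⟩
  intro τ hτ U hmild hmem hbdd n hn hnT
  obtain ⟨B, hB⟩ := hbdd
  set t0 : ℝ := (n : ℝ) * τ with ht0
  have hn1 : (1:ℝ) ≤ n := by exact_mod_cast hn
  have hlow : 0 ≤ t0 - τ := by rw [ht0]; nlinarith
  have hup : t0 + τ ≤ T := by rw [ht0]; linarith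
  have hTτ : τ ≤ T := by linarith
  have hctx : Ctx f L T (max B 1) U :=
    { fcont := hf.continuous
      fL := hfL
      mild := hmild
      reg := fun t ht => reg_of hr0 (hmem t ht) ((hB t ht).trans (le_max_left _ _))
      hT := hT
      hB := le_max_right _ _ }
  have hin : ∀ s ∈ Set.Icc (-τ) τ, t0 + s ∈ Set.Icc 0 T := fun s hs =>
    ⟨by linarith [hs.1], by linarith [hs.2]⟩
  set N1 : ℝ := ⨆ s ∈ Set.Icc (-τ) τ, pnorm (1+r) (U (t0 + s)) with hN1
  set N2 : ℝ := ⨆ s ∈ Set.Icc (-τ) τ, pnorm 0 (U (t0 + s)) with hN2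
  have hN2n : 0 ≤ N2 := Real.iSup_nonneg fun s => Real.iSup_nonneg fun _ => pnorm_nonneg
  have hN1n : 0 ≤ N1 := Real.iSup_nonneg fun s => Real.iSup_nonneg fun _ => pnorm_nonneg
  have hsup : ∀ s ∈ Set.Icc (-τ) τ, pnorm (1+r) (U (t0 + s)) ≤ N1 := by
    intro s hs
    have hbd : BddAbove (Set.range fun s => ⨆ (_ : s ∈ Set.Icc (-τ) τ), pnorm (1+r) (U (t0 + s))) := by
      refine ⟨max B 0, ?_⟩
      rintro _ ⟨y, rfl⟩
      apply Real.iSup_le _ (le_max_right _ _)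
      intro hy
      exact (hB _ (hin y hy)).trans (le_max_left _ _)
    have := le_ciSup hbd s
    simp only [hs, ciSup_unique] at this
    exact this
  set N : ℝ := 1 + N1 + N2 with hN
  have hNone : 1 ≤ N := by linarith
  have hReg : ∀ t ∈ Set.Icc (t0 - τ) (t0 + τ), Reg (U t) N := by
    intro t ht
    have hs : t - t0 ∈ Set.Icc (-τ) τ := ⟨by linarith [ht.1], by linarith [ht.2]⟩
    have h1 := hsup _ hs
    have h2 := hin _ hs
    rw [add_sub_cancel] at h1 h2
    exact reg_of hr0 (hmem t h2) (by linarith)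
  have hcore := hctx.core hNone hτ hlow hup hReg
  have hle := Real.le_sqrt_of_sq_le hcore
  have e1 : √(C0 f L T * τ^6 * N^2) = √(C0 f L T) * τ^3 * N := by
    rw [show C0 f L T * τ^6 * N^2 = C0 f L T * (τ^3 * N)^2 by ring, Real.sqrt_mul hC0,
      Real.sqrt_sq (by positivity)]
    ring
  rw [e1] at hle
  refine hle.trans ?_
  have e2 : τ^3 = τ ^ (1 - r) * τ ^ (2 + r) := by
    rw [← Real.rpow_add hτ, show (1 - r) + (2 + r) = ((3:ℕ):ℝ) by push_cast; ring,
      Real.rpow_natCast]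
  have e3 : τ ^ (1 - r) ≤ T ^ (1 - r) := Real.rpow_le_rpow hτ.le hTτ (by linarith)
  have hp : 0 < τ ^ (2 + r) := Real.rpow_pos_of_pos hτ _
  calc √(C0 f L T) * τ^3 * N = √(C0 f L T) * τ ^ (1 - r) * τ ^ (2 + r) * N := by rw [e2]; ring
    _ ≤ √(C0 f L T) * T ^ (1 - r) * τ ^ (2 + r) * N^2 := by
        gcongr
        nlinarith
    _ ≤ (√(C0 f L T) * T ^ (1 - r) + 1) * τ ^ (2 + r) * N^2 := by
        gcongr
        linarith


end KG
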